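/- arXiv:1503.07206 — 14 statements merged into one kernel-verified Lean document; each statement's English description precedes it below -/
import Mathlib

section
/- Let W and A be finite nonempty sets, let α be a Markov kernel from W×A to W, and let R: W×A → ℝ. Let J := { q ∈ Δ_{W×A} : for every w' ∈ W, Σ_{w∈W} Σ_{a∈A} q(w,a)·α(w'|w,a) = Σ_{a∈A} q(w',a) }. Then there exist p ∈ Δ_W and a function f: W → A such that the joint distribution q(w,a) := p(w)·[a = f(w)] belongs to J and satisfies Σ_{w,a} q(w,a)·R(w,a) ≥ Σ_{w,a} q'(w,a)·R(w,a) for every q' ∈ J. (Every MDP has a deterministic optimal stationary policy.) -/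
/-- Every stochastic matrix has a stationary distribution. -/
theorem aux_stationary {W : Type} [Fintype W] [Nonempty W]
    (P : W → W → ℝ) (hP : ∀ w, P w ∈ stdSimplex ℝ W) :
    ∃ p ∈ stdSimplex ℝ W, ∀ w', ∑ w, p w * P w w' = p w' := by
  classical
  let M : Matrix W W ℝ := 1 - Matrix.of P
  have h1 : ∃ v : W → ℝ, v ≠ 0 ∧ M.mulVec v = 0 := by
    refine ⟨fun _ => 1, ?_, ?_⟩
    · intro h
      obtain ⟨w⟩ := ‹Nonempty W›
      have := congrFun h w
      simp at this
    · funext w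
      have := (hP w).2
      simp [M, Matrix.mulVec, dotProduct, this, Matrix.one_apply]
  have hdet : M.det = 0 := Matrix.exists_mulVec_eq_zero_iff.mp h1
  obtain ⟨v, hv0, hv⟩ := Matrix.exists_vecMul_eq_zero_iff.mpr hdet
  have hv' : ∀ w', ∑ w, v w * P w w' = v w' := by
    intro w'
    have h := congrFun hv w'
    simp only [M, Matrix.vecMul_sub, Matrix.vecMul_one, Pi.sub_apply, Pi.zero_apply] at h
    simp only [Matrix.vecMul, dotProduct, Matrix.of_apply] at h
    linarith
  have hle : ∀ w', |v w'| ≤ ∑ w, |v w| * P w w' := by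
    intro w'
    calc |v w'| = |∑ w, v w * P w w'| := by rw [hv']
      _ ≤ ∑ w, |v w * P w w'| := Finset.abs_sum_le_sum_abs _ _
      _ = ∑ w, |v w| * P w w' := by
        refine Finset.sum_congr rfl fun w _ => ?_
        rw [abs_mul, abs_of_nonneg ((hP w).1 w')]
  have hsum : ∑ w', |v w'| = ∑ w', ∑ w, |v w| * P w w' := by
    rw [Finset.sum_comm]
    refine Finset.sum_congr rfl fun w _ => ?_
    rw [← Finset.mul_sum, (hP w).2, mul_one]
  have heq : ∀ w', |v w'| = ∑ w, |v w| * P w w' := by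
    have := (Finset.sum_eq_sum_iff_of_le (fun w' _ => hle w')).mp hsum
    exact fun w' => this w' (Finset.mem_univ _)
  have hpos : 0 < ∑ w, |v w| := by
    obtain ⟨w, hw⟩ := Function.ne_iff.mp hv0
    exact Finset.sum_pos' (fun _ _ => abs_nonneg _) ⟨w, Finset.mem_univ _, abs_pos.mpr hw⟩
  refine ⟨fun w => |v w| / ∑ w, |v w|, ⟨fun w => by positivity, ?_⟩, ?_⟩
  · rw [← Finset.sum_div, div_self hpos.ne']
  · intro w'
    dsimp only
    rw [heq w', Finset.sum_div]
    refine Finset.sum_congr rfl fun w _ => ?_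
    ring

/-- Direction of perturbation at a non-deterministic point. -/
theorem aux_dir {W A : Type} [Fintype W] [Fintype A]
    (α : W → A → W → ℝ) (hα : ∀ w a, α w a ∈ stdSimplex ℝ W)
    (q : W × A → ℝ) (hq : q ∈ stdSimplex ℝ (W × A))
    (hst : ∀ w' : W, ∑ w : W, ∑ a : A, q (w, a) * α w a w' = ∑ a : A, q (w', a))
    (w0 : W) (a1 a2 : A) (h12 : a1 ≠ a2) (h1 : q (w0, a1) ≠ 0) (h2 : q (w0, a2) ≠ 0) :
    ∃ d : W × A → ℝ, d ≠ 0 ∧ (∀ x, q x = 0 → d x = 0) ∧ ∑ x, d x = 0 ∧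
      ∀ w' : W, ∑ w : W, ∑ a : A, d (w, a) * α w a w' = ∑ a : A, d (w', a) := by
  classical
  let S := {x : W × A // q x ≠ 0}
  let T := {w : W // ∃ a, q (w, a) ≠ 0}
  let v : S → (T → ℝ) := fun x w' =>
    if w'.1 = w0 then 1 else α x.1.1 x.1.2 w'.1 - (if x.1.1 = w'.1 then 1 else 0)
  have hcard : Fintype.card T < Fintype.card S := by
    refine Fintype.card_lt_of_surjective_not_injective
      (fun x : S => (⟨x.1.1, x.1.2, x.2⟩ : T)) ?_ ?_
    · rintro ⟨w, a, h⟩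
      exact ⟨⟨(w, a), h⟩, rfl⟩
    · intro hinj
      have := @hinj ⟨(w0, a1), h1⟩ ⟨(w0, a2), h2⟩ rfl
      exact h12 (congrArg (fun x : S => x.1.2) this)
  have hli : ¬ LinearIndependent ℝ v := by
    intro h
    have := h.fintype_card_le_finrank
    rw [Module.finrank_fintype_fun_eq_card] at this
    omega
  obtain ⟨g, hg, i, hi⟩ := Fintype.not_linearIndependent_iff.mp hli
  let d : W × A → ℝ := fun x => if h : q x ≠ 0 then g ⟨x, h⟩ else 0
  have hd0 : ∀ x, q x = 0 → d x = 0 := fun x hx => by simp [d, hx]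
  have hdS : ∀ x : S, d x.1 = g x := fun x => by simp [d, x.2]
  have hsumS : ∀ c : W × A → ℝ, ∑ x, d x * c x = ∑ x : S, g x * c x.1 := by
    intro c
    have e1 : ∑ x : S, g x * c x.1 = ∑ x : S, d x.1 * c x.1 :=
      Finset.sum_congr rfl fun x _ => by rw [hdS]
    rw [e1, ← Finset.sum_subtype (Finset.univ.filter fun x => q x ≠ 0) (by simp)
      (fun x => d x * c x)]
    symm
    refine Finset.sum_subset (Finset.subset_univ _) fun x _ hx => ?_
    have : q x = 0 := by simpa using hx
    rw [hd0 x this, zero_mul]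
  have hsum0 : ∑ x, d x = 0 := by
    have h := congrFun hg ⟨w0, a1, h1⟩
    have h' := hsumS (fun _ => 1)
    simp only [mul_one] at h'
    rw [h']
    simpa [v, Finset.sum_apply] using h
  have hmarg : ∀ w', ∑ x : W × A, d x * (if x.1 = w' then 1 else 0) = ∑ a, d (w', a) := by
    intro w'
    rw [Fintype.sum_prod_type, Finset.sum_eq_single w']
    · simp
    · intro b _ hb
      simp [hb]
    · simp
  have hflow : ∀ w', w' ≠ w0 →
      ∑ w : W, ∑ a : A, d (w, a) * α w a w' = ∑ a : A, d (w', a) := by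
    intro w' hw'
    rw [← Fintype.sum_prod_type' (f := fun w a => d (w, a) * α w a w')]
    by_cases hT : ∃ a, q (w', a) ≠ 0
    · have h := congrFun hg ⟨w', hT⟩
      have h' := hsumS (fun x => α x.1 x.2 w' - (if x.1 = w' then 1 else 0))
      have h'' : ∑ x : S, g x * (α x.1.1 x.1.2 w' - (if x.1.1 = w' then 1 else 0)) = 0 := by
        simpa [v, Finset.sum_apply, hw'] using h
      rw [h''] at h'
      simp only [mul_sub, Finset.sum_sub_distrib] at h'
      rw [hmarg] at h'
      linarith
    · push Not at hT
      have hz : ∑ x : W × A, q x * α x.1 x.2 w' = 0 := by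
        have := hst w'
        rw [← Fintype.sum_prod_type' (f := fun w a => q (w, a) * α w a w')] at this
        rw [this]
        exact Finset.sum_eq_zero fun a _ => hT a
      have hz' := (Finset.sum_eq_zero_iff_of_nonneg
        (fun x _ => mul_nonneg (hq.1 x) ((hα x.1 x.2).1 w'))).mp hz
      rw [Finset.sum_eq_zero, Finset.sum_eq_zero]
      · intro a _
        exact hd0 _ (hT a)
      · intro x _
        rcases mul_eq_zero.mp (hz' x (Finset.mem_univ _)) with h | h
        · change d x * _ = 0
          rw [hd0 x h, zero_mul]
        · rw [h, mul_zero]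
  refine ⟨d, ?_, hd0, hsum0, ?_⟩
  · intro h
    apply hi
    rw [← hdS, h]
    rfl
  · intro w'
    by_cases hw' : w' = w0
    · subst hw'
      have htot : ∑ u : W, ((∑ w : W, ∑ a : A, d (w, a) * α w a u) - ∑ a : A, d (u, a)) = 0 := by
        rw [Finset.sum_sub_distrib, sub_eq_zero, Finset.sum_comm]
        refine Finset.sum_congr rfl fun w _ => ?_
        rw [Finset.sum_comm]
        refine Finset.sum_congr rfl fun a _ => ?_
        rw [← Finset.mul_sum, (hα w a).2, mul_one]
      rw [Finset.sum_eq_single w'] at htot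
      · linarith
      · intro b _ hb
        rw [hflow b hb, sub_self]
      · simp
    · exact hflow w' hw'

theorem aux_move {ι : Type} [Fintype ι] (q d : ι → ℝ) (hq : ∀ x, 0 ≤ q x)
    (hd : d ≠ 0) (hs : ∑ x, d x = 0) (hd0 : ∀ x, q x = 0 → d x = 0) :
    ∃ t : ℝ, 0 ≤ t ∧ (∀ x, 0 ≤ q x + t * d x) ∧ ∃ i, q i ≠ 0 ∧ q i + t * d i = 0 := by
  classical
  have hneg : ∃ x, d x < 0 := by
    by_contra! h
    apply hd
    funext x
    exact (Finset.sum_eq_zero_iff_of_nonneg (fun x _ => h x)).mp hs x (Finset.mem_univ _)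
  obtain ⟨x0, hx0⟩ := hneg
  obtain ⟨i, hi, hmin⟩ := Finset.exists_min_image (Finset.univ.filter fun x => d x < 0)
    (fun x => q x / (- d x)) ⟨x0, by simpa using hx0⟩
  have hi : d i < 0 := by simpa using hi
  have ht : 0 ≤ q i / (- d i) := div_nonneg (hq i) (by linarith)
  refine ⟨q i / (- d i), ht, ?_, i, fun h => hi.ne (hd0 i h), ?_⟩
  · intro x
    rcases lt_or_ge (d x) 0 with h | h
    · have := hmin x (by simpa using h)
      rw [le_div_iff₀ (by linarith)] at this
      linarith
    · have := mul_nonneg ht h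
      have := hq x
      linarith
  · have : d i ≠ 0 := hi.ne
    field_simp
    ring

/-- Every finite MDP has a deterministic optimal stationary policy:
there are a world-state distribution `p` and a deterministic policy `f : W → A` such that
the induced joint distribution is stationary and maximizes the expected reward over `J`. -/
theorem stmt_0
    {W A : Type} [Fintype W] [Fintype A] [Nonempty W] [Nonempty A] [DecidableEq A]
    (α : W → A → W → ℝ) (hα : ∀ w a, α w a ∈ stdSimplex ℝ W)
    (R : W → A → ℝ)
    (J : Set (W × A → ℝ))
    (hJ : J = {q | q ∈ stdSimplex ℝ (W × A) ∧
      ∀ w' : W, ∑ w : W, ∑ a : A, q (w, a) * α w a w' = ∑ a : A, q (w', a)}) :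
    ∃ p ∈ stdSimplex ℝ W, ∃ f : W → A,
      (fun wa : W × A => p wa.1 * (if wa.2 = f wa.1 then (1 : ℝ) else 0)) ∈ J ∧
      ∀ q' ∈ J,
        ∑ wa : W × A, p wa.1 * (if wa.2 = f wa.1 then (1 : ℝ) else 0) * R wa.1 wa.2
          ≥ ∑ wa : W × A, q' wa * R wa.1 wa.2 := by
  classical
  have hne : J.Nonempty := by
    obtain ⟨a0⟩ := ‹Nonempty A›
    obtain ⟨p, hp, hst⟩ := aux_stationary (fun w => α w a0) (fun w => hα w a0)
    refine ⟨fun x => if x.2 = a0 then p x.1 else 0, ?_⟩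
    rw [hJ]
    refine ⟨⟨fun x => ?_, ?_⟩, fun w' => ?_⟩
    · dsimp only
      split_ifs
      · exact hp.1 _
      · exact le_rfl
    · rw [Fintype.sum_prod_type]
      simpa using hp.2
    · simpa using hst w'
  have hcomp : IsCompact J := by
    have : J = stdSimplex ℝ (W × A) ∩ {q | ∀ w' : W,
        ∑ w : W, ∑ a : A, q (w, a) * α w a w' = ∑ a : A, q (w', a)} := by
      rw [hJ]; rfl
    rw [this]
    refine (isCompact_stdSimplex ℝ (W × A)).inter_right ?_
    simp only [Set.ofPred_forall]
    refine isClosed_iInter fun w' => isClosed_eq ?_ ?_ <;> fun_prop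
  let F : (W × A → ℝ) → ℝ := fun q => ∑ wa : W × A, q wa * R wa.1 wa.2
  have hF : Continuous F := by fun_prop
  obtain ⟨qm, hqm, hmax⟩ := hcomp.exists_isMaxOn hne hF.continuousOn
  let N : (W × A → ℝ) → ℕ := fun q => (Finset.univ.filter fun x => q x ≠ 0).card
  obtain ⟨q, ⟨hqJ, hqmax⟩, hqmin⟩ := (measure N).wf.has_min
    {q | q ∈ J ∧ ∀ q' ∈ J, F q' ≤ F q} ⟨qm, hqm, fun q' h => hmax h⟩
  have hq' := hqJ
  rw [hJ] at hq'
  obtain ⟨hqs, hst⟩ := hq'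
  have hdet : ∀ w a1 a2, q (w, a1) ≠ 0 → q (w, a2) ≠ 0 → a1 = a2 := by
    intro w0 a1 a2 h1 h2
    by_contra h12
    have key : ∃ d : W × A → ℝ, 0 ≤ F d ∧ d ≠ 0 ∧ (∀ x, q x = 0 → d x = 0) ∧ ∑ x, d x = 0 ∧
      ∀ w' : W, ∑ w : W, ∑ a : A, d (w, a) * α w a w' = ∑ a : A, d (w', a) := by
      obtain ⟨d, hd, hd0, hs, hf⟩ := aux_dir α hα q hqs hst w0 a1 a2 h12 h1 h2
      rcases le_total 0 (F d) with h | h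
      · exact ⟨d, h, hd, hd0, hs, hf⟩
      · refine ⟨-d, ?_, neg_ne_zero.mpr hd, ?_, ?_, ?_⟩
        · simp only [F, Pi.neg_apply, neg_mul, Finset.sum_neg_distrib] at h ⊢
          linarith
        · intro x hx
          simp [hd0 x hx]
        · simp [hs]
        · intro w'
          simp [hf w']
    obtain ⟨d, hFd, hd, hd0, hs, hf⟩ := key
    obtain ⟨t, ht, hnn, i, hi, hit⟩ := aux_move q d hqs.1 hd hs hd0
    let q2 : W × A → ℝ := fun x => q x + t * d x
    have hq2J : q2 ∈ J := by
      rw [hJ]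
      refine ⟨⟨hnn, ?_⟩, fun w' => ?_⟩
      · simp only [q2, Finset.sum_add_distrib, ← Finset.mul_sum, hs, hqs.2]
        ring
      · simp only [q2, add_mul, Finset.sum_add_distrib, mul_assoc, ← Finset.mul_sum, hf, hst]
    have hFq2 : F q2 = F q + t * F d := by
      simp only [F, q2, add_mul, Finset.sum_add_distrib, mul_assoc, ← Finset.mul_sum]
    refine hqmin q2 ⟨hq2J, fun q' hq' => ?_⟩ ?_
    · have := hqmax q' hq'
      have := mul_nonneg ht hFd
      linarith
    · change N q2 < N q
      refine Finset.card_lt_card ?_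
      rw [Finset.ssubset_iff_of_subset]
      · exact ⟨i, by simpa using hi, by simpa [q2] using hit⟩
      · intro x hx
        simp only [Finset.mem_filter, Finset.mem_univ, true_and] at hx ⊢
        intro h
        apply hx
        simp [q2, h, hd0 x h]
  have hfex : ∀ w, ∃ a, ∀ b, b ≠ a → q (w, b) = 0 := by
    intro w
    by_cases h : ∃ a, q (w, a) ≠ 0
    · obtain ⟨a, ha⟩ := h
      refine ⟨a, fun b hb => ?_⟩
      by_contra hqb
      exact hb (hdet w b a hqb ha)
    · push Not at h
      exact ⟨Classical.arbitrary A, fun b _ => h b⟩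
  choose f hf using hfex
  have hqeq : ∀ x : W × A, (∑ a, q (x.1, a)) * (if x.2 = f x.1 then (1 : ℝ) else 0) = q x := by
    rintro ⟨w, a⟩
    dsimp only
    rw [Finset.sum_eq_single (f w) (fun b _ hb => hf w b hb) (by simp)]
    split_ifs with h
    · rw [h, mul_one]
    · rw [hf w a h, mul_zero]
  refine ⟨fun w => ∑ a, q (w, a), ⟨fun w => Finset.sum_nonneg fun a _ => hqs.1 _, ?_⟩, f, ?_, ?_⟩
  · rw [← Fintype.sum_prod_type]
    exact hqs.2
  · simp only [hqeq]
    exact hqJ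
  · intro q' h'
    simp only [hqeq]
    exact hqmax q' h'
end

section
/- Let W and A be finite nonempty sets and let α be a Markov kernel from W×A to W. Let J := { q ∈ Δ_{W×A} : for every w' ∈ W, Σ_{w∈W} Σ_{a∈A} q(w,a)·α(w'|w,a) = Σ_{a∈A} q(w',a) }. If q is an extreme point of the convex set J, then for every w ∈ W there is at most one a ∈ A with q(w,a) > 0; equivalently, q(w,a) = p(w)·[a = f(w)] for some p ∈ Δ_W and some function f: W → A. -/
/-- The defect of the stationarity equation at `w`. -/
noncomputable def defectMap {W A : Type} [Fintype W] [Fintype A] (α : W → A → W → ℝ) (w : W) :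
    (W × A → ℝ) →ₗ[ℝ] ℝ where
  toFun d := ∑ v : W, ∑ a : A, d (v, a) * α v a w - ∑ a : A, d (w, a)
  map_add' x y := by
    simp only [Pi.add_apply, add_mul, Finset.sum_add_distrib]; ring
  map_smul' c x := by
    simp only [Pi.smul_apply, smul_eq_mul, mul_assoc, ← Finset.mul_sum, RingHom.id_apply]; ring

/-- The total mass. -/
noncomputable def massMap (W A : Type) [Fintype W] [Fintype A] :
    (W × A → ℝ) →ₗ[ℝ] ℝ where
  toFun d := ∑ x, d x
  map_add' x y := by simp [Finset.sum_add_distrib]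
  map_smul' c x := by simp [Finset.mul_sum]

lemma sum_defect {W A : Type} [Fintype W] [Fintype A] (α : W → A → W → ℝ)
    (hα : ∀ w a, α w a ∈ stdSimplex ℝ W) (d : W × A → ℝ) :
    ∑ w, defectMap α w d = 0 := by
  simp only [defectMap, LinearMap.coe_mk, AddHom.coe_mk, Finset.sum_sub_distrib]
  rw [Finset.sum_comm, sub_eq_zero]
  refine Finset.sum_congr rfl fun v _ => ?_
  rw [Finset.sum_comm]
  refine Finset.sum_congr rfl fun a _ => ?_
  rw [← Finset.mul_sum, (hα v a).2, mul_one]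

open Classical in
/-- There is a nonzero feasible direction when two actions are used in one state. -/
lemma exists_direction {W A : Type} [Fintype W] [Fintype A]
    (α : W → A → W → ℝ) (hα : ∀ w a, α w a ∈ stdSimplex ℝ W)
    (q : W × A → ℝ) (hq0 : ∀ x, 0 ≤ q x) (hst : ∀ w, defectMap α w q = 0)
    (w₀ : W) (a a' : A) (ha : 0 < q (w₀, a)) (ha' : 0 < q (w₀, a')) (hne : a ≠ a') :
    ∃ d : W × A → ℝ, d ≠ 0 ∧ (∀ x, q x = 0 → d x = 0) ∧ massMap W A d = 0 ∧
      ∀ w, defectMap α w d = 0 := by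
  have hf : ∀ w, ∃ b, (∃ c, 0 < q (w, c)) → 0 < q (w, b) := by
    intro w
    by_cases h : ∃ c, 0 < q (w, c)
    · obtain ⟨c, hc⟩ := h
      exact ⟨c, fun _ => hc⟩
    · exact ⟨a, fun h' => absurd h' h⟩
  choose f hf using hf
  obtain ⟨b, hb, hbf⟩ : ∃ b, 0 < q (w₀, b) ∧ b ≠ f w₀ := by
    by_cases h : a = f w₀
    · exact ⟨a', ha', fun h' => hne (h.trans h'.symm)⟩
    · exact ⟨a, ha, h⟩
  let T : (W × A → ℝ) →ₗ[ℝ] (W × A → ℝ) := LinearMap.pi fun x =>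
    if q x = 0 then LinearMap.proj x else
      if x.2 = f x.1 then (if x.1 = w₀ then massMap W A else defectMap α x.1) else 0
  have hTs : ¬ Function.Surjective T := by
    intro h
    obtain ⟨d, hd⟩ := h (fun _ => 1)
    have := congrFun hd (w₀, b)
    simp [T, hb.ne', hbf] at this
  have hTi : ¬ Function.Injective T := fun h => hTs (LinearMap.injective_iff_surjective.1 h)
  rw [injective_iff_map_eq_zero] at hTi
  push Not at hTi
  obtain ⟨d, hd, hd0⟩ := hTi
  have hsupp : ∀ x, q x = 0 → d x = 0 := by
    intro x hx
    have := congrFun hd x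
    simpa [T, hx] using this
  have hdef : ∀ w, w ≠ w₀ → defectMap α w d = 0 := by
    intro w hw
    by_cases h : ∃ c, 0 < q (w, c)
    · have := congrFun hd (w, f w)
      simpa [T, (hf w h).ne', hw] using this
    · push Not at h
      have hz : ∀ c, q (w, c) = 0 := fun c => le_antisymm (h c) (hq0 _)
      have h1 := hst w
      simp only [defectMap, LinearMap.coe_mk, AddHom.coe_mk, hz, Finset.sum_const_zero,
        sub_zero] at h1 ⊢
      have hnn : ∀ v c, 0 ≤ q (v, c) * α v c w := fun v c => mul_nonneg (hq0 _) ((hα v c).1 w)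
      have h2 : ∀ v c, q (v, c) * α v c w = 0 := by
        intro v c
        have h3 := (Finset.sum_eq_zero_iff_of_nonneg
          (fun v _ => Finset.sum_nonneg fun c _ => hnn v c)).1 h1 v (Finset.mem_univ _)
        exact (Finset.sum_eq_zero_iff_of_nonneg (fun c _ => hnn v c)).1 h3 c (Finset.mem_univ _)
      have h4 : ∀ v c, d (v, c) * α v c w = 0 := by
        intro v c
        rcases mul_eq_zero.1 (h2 v c) with h | h
        · rw [hsupp _ h, zero_mul]
        · rw [h, mul_zero]
      simp [h4, hsupp _ (hz _)]
  refine ⟨d, hd0, hsupp, ?_, ?_⟩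
  · have := congrFun hd (w₀, f w₀)
    simpa [T, (hf w₀ ⟨a, ha⟩).ne'] using this
  · intro w
    by_cases hw : w = w₀
    · subst hw
      rw [← sum_defect α hα d]
      exact (Finset.sum_eq_single w (fun v _ hv => hdef v hv) (by simp)).symm
    · exact hdef w hw

lemma exists_eps {X : Type} [Fintype X] (q d : X → ℝ) (hq : ∀ x, 0 ≤ q x)
    (h : ∀ x, q x = 0 → d x = 0) : ∃ ε : ℝ, 0 < ε ∧ ∀ x, ε * |d x| ≤ q x := by
  have key : ∀ᶠ ε : ℝ in nhdsWithin 0 (Set.Ioi 0), ∀ x, ε * |d x| ≤ q x := by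
    rw [Filter.eventually_all]
    intro x
    rcases (hq x).eq_or_lt with h0 | h0
    · refine Filter.Eventually.of_forall fun ε => ?_
      rw [h x h0.symm, ← h0]; simp
    · apply Filter.Eventually.filter_mono nhdsWithin_le_nhds
      have hc : Continuous fun ε : ℝ => ε * |d x| := by fun_prop
      have := hc.tendsto 0
      simp only [zero_mul] at this
      exact (this.eventually (gt_mem_nhds h0)).mono fun _ h => le_of_lt h
  obtain ⟨ε, h1, h2⟩ := (key.and self_mem_nhdsWithin).exists
  exact ⟨ε, h2, h1⟩

/-- Every extreme point of the stationarity polytope `J` of an MDP is a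
joint distribution of the form `q(w,a) = p(w)·[a = f(w)]`, i.e. it is induced by a
deterministic policy. -/
theorem stmt_1
    {W A : Type} [Fintype W] [Fintype A] [Nonempty W] [Nonempty A] [DecidableEq A]
    (α : W → A → W → ℝ) (hα : ∀ w a, α w a ∈ stdSimplex ℝ W)
    (J : Set (W × A → ℝ))
    (hJ : J = {q | q ∈ stdSimplex ℝ (W × A) ∧
      ∀ w' : W, ∑ w : W, ∑ a : A, q (w, a) * α w a w' = ∑ a : A, q (w', a)})
    (q : W × A → ℝ) (hq : q ∈ J.extremePoints ℝ) :
    (∀ w : W, ∀ a a' : A, 0 < q (w, a) → 0 < q (w, a') → a = a') ∧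
    ∃ p ∈ stdSimplex ℝ W, ∃ f : W → A,
      ∀ wa : W × A, q wa = p wa.1 * (if wa.2 = f wa.1 then (1 : ℝ) else 0) := by
  have hmem : ∀ r : W × A → ℝ, r ∈ J ↔ (∀ x, 0 ≤ r x) ∧ massMap W A r = 1 ∧
      ∀ w, defectMap α w r = 0 := by
    intro r
    simp only [hJ, Set.mem_setOf_eq, stdSimplex, massMap, defectMap, LinearMap.coe_mk,
      AddHom.coe_mk, sub_eq_zero, and_assoc]
  obtain ⟨hq0, hq1, hq2⟩ := (hmem q).1 hq.1
  have huniq : ∀ w : W, ∀ a a' : A, 0 < q (w, a) → 0 < q (w, a') → a = a' := by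
    intro w a a' ha ha'
    by_contra hne
    obtain ⟨d, hd0, hds, hdm, hdd⟩ := exists_direction α hα q hq0 hq2 w a a' ha ha' hne
    obtain ⟨ε, hε, hle⟩ := exists_eps q d hq0 hds
    have hp : q + ε • d ∈ J := by
      rw [hmem]
      refine ⟨fun x => ?_, by simp [hq1, hdm], fun w => by simp [hq2, hdd]⟩
      have h1 := hle x
      have h2 := mul_le_mul_of_nonneg_left (neg_abs_le (d x)) hε.le
      simp only [Pi.add_apply, Pi.smul_apply, smul_eq_mul]
      linarith
    have hm : q - ε • d ∈ J := by
      rw [hmem]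
      refine ⟨fun x => ?_, by simp [hq1, hdm], fun w => by simp [hq2, hdd]⟩
      have h1 := hle x
      have h2 := mul_le_mul_of_nonneg_left (le_abs_self (d x)) hε.le
      simp only [Pi.sub_apply, Pi.smul_apply, smul_eq_mul]
      linarith
    have hseg : q ∈ openSegment ℝ (q + ε • d) (q - ε • d) := by
      refine ⟨1 / 2, 1 / 2, by norm_num, by norm_num, by norm_num, ?_⟩
      ext x
      simp only [Pi.add_apply, Pi.sub_apply, Pi.smul_apply, smul_eq_mul]
      ring
    have heq := hq.2 hp hm hseg
    have h0 : ε • d = 0 := by simpa using heq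
    rcases smul_eq_zero.1 h0 with h | h
    · exact hε.ne' h
    · exact hd0 h
  refine ⟨huniq, fun w => ∑ a, q (w, a), ⟨fun w => Finset.sum_nonneg fun a _ => hq0 _, ?_⟩, ?_⟩
  · rw [← hq1]
    exact (Fintype.sum_prod_type q).symm
  have hf : ∀ w, ∃ b, ∀ c, c ≠ b → q (w, c) = 0 := by
    intro w
    by_cases h : ∃ b, 0 < q (w, b)
    · obtain ⟨b, hb⟩ := h
      refine ⟨b, fun c hc => ?_⟩
      by_contra h0
      exact hc (huniq w c b (lt_of_le_of_ne (hq0 _) (Ne.symm h0)) hb)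
    · push Not at h
      exact ⟨Classical.arbitrary A, fun c _ => le_antisymm (h c) (hq0 _)⟩
  choose f hf using hf
  refine ⟨f, ?_⟩
  rintro ⟨w, a⟩
  by_cases h : a = f w
  · subst h
    simp only [if_true, mul_one]
    exact (Finset.sum_eq_single (f w) (fun c _ hc => hf w c hc) (by simp)).symm
  · simp [h, hf w a h]
end

section
/- Let W, S, A be finite nonempty sets, let α be a Markov kernel from W×A to W, let β be a Markov kernel from W to S, and let R: W×A → ℝ. Let U := { s ∈ S : |{ w ∈ W : β(s|w) > 0 }| > 1 }, let J := { q ∈ Δ_{W×A} : for every w' ∈ W, Σ_{w,a} q(w,a)·α(w'|w,a) = Σ_a q(w',a) }, and let FJ := { q ∈ J : there exist p ∈ Δ_W and a Markov kernel π from S to A with q(w,a) = p(w)·Σ_{s∈S} β(s|w)·π(a|s) for all w,a }. Then there exist a Markov kernel π* from S to A with |{ (s,a) : π*(a|s) > 0 }| ≤ |S| + |U|·(|A|−1) and p* ∈ Δ_W such that q*(w,a) := p*(w)·Σ_s β(s|w)·π*(a|s) belongs to J and satisfies Σ_{w,a} q*(w,a)·R(w,a) ≥ Σ_{w,a} q(w,a)·R(w,a)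 for every q ∈ FJ. (Every POMDP has a |U|(|A|−1)-stochastic optimal stationary policy for the average reward.) -/
open Finset in
theorem aux_hit {ι : Type} [Fintype ι] (c d : ι → ℝ) (hc : ∀ i, 0 ≤ c i)
    (hz : ∀ i, c i = 0 → d i = 0) (hn : ∃ i, d i < 0) :
    ∃ ε : ℝ, 0 < ε ∧ (∀ i, 0 ≤ c i + ε * d i) ∧ ∃ i, 0 < c i ∧ c i + ε * d i = 0 := by
  classical
  have hpos : ∀ i, d i < 0 → 0 < c i := fun i hi =>
    lt_of_le_of_ne (hc i) (fun h => by have := hz i h.symm; linarith)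
  obtain ⟨j, hj, hmin⟩ := Finset.exists_min_image (univ.filter fun i => d i < 0)
    (fun i => c i / (- d i)) (by obtain ⟨i, hi⟩ := hn; exact ⟨i, by simpa using hi⟩)
  simp only [mem_filter, mem_univ, true_and] at hj hmin
  have hcj := hpos j hj
  have hnj : 0 < - d j := by linarith
  have he : 0 < c j / (- d j) := div_pos hcj hnj
  refine ⟨c j / (- d j), he, ?_, j, hcj, ?_⟩
  · intro i
    by_cases hi : d i < 0
    · have h1 := hmin i hi
      have hni : 0 < - d i := by linarith
      rw [le_div_iff₀ hni] at h1
      linarith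
    · have := mul_nonneg he.le (not_lt.mp hi)
      have := hc i
      linarith
  · have : c j / (- d j) * (- d j) = c j := div_mul_cancel₀ _ hnj.ne'
    linarith

/-- kernel direction -/
theorem aux_dir_s2 {W : Type} [Fintype W] (P : W → W → ℝ) (hP0 : ∀ w w', 0 ≤ P w w')
    (hP1 : ∀ w, ∑ w', P w w' = 1) (p : W → ℝ) (hp0 : ∀ w, 0 ≤ p w)
    (hst : ∀ w', ∑ w, p w * P w w' = p w') (w0 : W) (hw0 : 0 < p w0)
    (z : W → ℝ) (hz1 : ∑ w, z w = 0) (hz : ∀ w, p w = 0 → z w = 0) :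
    ∃ (ξ : W → ℝ) (t : ℝ), (ξ ≠ 0 ∨ t ≠ 0) ∧ (∀ w, p w = 0 → ξ w = 0) ∧ ∑ w, ξ w = 0 ∧
      ∀ w', ∑ w, ξ w * P w w' + t * z w' = ξ w' := by
  classical
  let L : ((W → ℝ) × ℝ) →ₗ[ℝ] (W → ℝ) :=
    { toFun := fun x w' => if w' = w0 then ∑ w, x.1 w else if p w' = 0 then x.1 w' else
        ∑ w, x.1 w * P w w' + x.2 * z w' - x.1 w'
      map_add' := by
        intro x y
        funext w'
        simp only [Prod.fst_add, Prod.snd_add, Pi.add_apply, add_mul, Finset.sum_add_distrib]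
        split_ifs <;> ring
      map_smul' := by
        intro r x
        funext w'
        simp only [Prod.smul_fst, Prod.smul_snd, Pi.smul_apply, smul_eq_mul, RingHom.id_apply,
          mul_assoc, ← Finset.mul_sum]
        split_ifs <;> ring }
  have hk : LinearMap.ker L ≠ ⊥ := by
    apply LinearMap.ker_ne_bot_of_finrank_lt
    simp
  obtain ⟨x, hx, hx0⟩ := (Submodule.ne_bot_iff _).1 hk
  obtain ⟨ξ, t⟩ := x
  have hL : ∀ w', (if w' = w0 then ∑ w, ξ w else if p w' = 0 then ξ w' else
        ∑ w, ξ w * P w w' + t * z w' - ξ w') = 0 := fun w' => congrFun (LinearMap.mem_ker.1 hx) w'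
  have hsum : ∑ w, ξ w = 0 := by simpa using hL w0
  have hsupp : ∀ w, p w = 0 → ξ w = 0 := by
    intro w hw
    have hne : w ≠ w0 := by rintro rfl; linarith
    simpa [hne, hw] using hL w
  have hoff : ∀ w', w' ≠ w0 → ∑ w, ξ w * P w w' + t * z w' - ξ w' = 0 := by
    intro w' hne
    by_cases hw : p w' = 0
    · rw [hsupp w' hw, hz w' hw]
      have h1 := hst w'
      rw [hw, Finset.sum_eq_zero_iff_of_nonneg (fun w _ => mul_nonneg (hp0 w) (hP0 w w'))] at h1
      have : ∑ w, ξ w * P w w' = 0 := by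
        apply Finset.sum_eq_zero
        intro w _
        rcases mul_eq_zero.1 (h1 w (Finset.mem_univ _)) with h | h
        · rw [hsupp w h, zero_mul]
        · rw [h, mul_zero]
      rw [this]; ring
    · simpa [hne, hw] using hL w'
  have htot : ∑ w', (∑ w, ξ w * P w w' + t * z w' - ξ w') = 0 := by
    rw [Finset.sum_sub_distrib, Finset.sum_add_distrib, Finset.sum_comm]
    simp only [← Finset.mul_sum, hP1, hz1, mul_one]
    ring
  rw [Finset.sum_eq_single w0 (fun w _ h => hoff w h) (by simp)] at htot
  refine ⟨ξ, t, ?_, hsupp, hsum, ?_⟩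
  · by_contra h
    push Not at h
    exact hx0 (Prod.ext h.1 h.2)
  · intro w'
    by_cases h : w' = w0
    · subst h; linarith
    · linarith [hoff w' h]

theorem aux_stat {W : Type} [Fintype W] [Nonempty W] (P : W → W → ℝ) (hP0 : ∀ w w', 0 ≤ P w w')
    (hP1 : ∀ w, ∑ w', P w w' = 1) :
    ∃ p ∈ stdSimplex ℝ W, ∀ w', ∑ w, p w * P w w' = p w' := by
  classical
  let M : Matrix W W ℝ := Matrix.of P - 1
  have hdet : M.det = 0 := by
    apply Matrix.exists_mulVec_eq_zero_iff.1
    refine ⟨fun _ => 1, ?_, ?_⟩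
    · intro h
      exact one_ne_zero (congrFun h (Classical.arbitrary W))
    · funext w
      simp only [M, Matrix.sub_mulVec, Matrix.one_mulVec]
      simp [Matrix.mulVec, dotProduct, hP1]
  obtain ⟨v, hv, hvM⟩ := Matrix.exists_vecMul_eq_zero_iff.2 hdet
  have hst : ∀ w', ∑ w, v w * P w w' = v w' := by
    intro w'
    have := congrFun hvM w'
    simp only [M, Matrix.vecMul_sub, Matrix.vecMul_one] at this
    simp [Matrix.vecMul, dotProduct] at this
    linarith
  have hle : ∀ w', |v w'| ≤ ∑ w, |v w| * P w w' := by
    intro w'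
    rw [← hst w']
    refine (Finset.abs_sum_le_sum_abs _ _).trans (le_of_eq ?_)
    refine Finset.sum_congr rfl fun w _ => ?_
    rw [abs_mul, abs_of_nonneg (hP0 w w')]
  have htot : ∑ w', |v w'| = ∑ w', ∑ w, |v w| * P w w' := by
    rw [Finset.sum_comm]
    simp only [← Finset.mul_sum, hP1, mul_one]
  have heq := (Finset.sum_eq_sum_iff_of_le (fun w' _ => hle w')).1 htot
  have hpos : 0 < ∑ w, |v w| := by
    obtain ⟨w, hw⟩ := Function.ne_iff.1 hv
    exact Finset.sum_pos' (fun _ _ => abs_nonneg _) ⟨w, Finset.mem_univ _, abs_pos.2 hw⟩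
  refine ⟨fun w => |v w| / ∑ w, |v w|, ⟨fun w => by positivity, ?_⟩, ?_⟩
  · rw [← Finset.sum_div, div_self hpos.ne']
  · intro w'
    simp only [div_mul_eq_mul_div, ← Finset.sum_div]
    rw [← heq w' (Finset.mem_univ _)]

/-- effective policy -/
noncomputable def auxK {W S A : Type} [Fintype S] (β : W → S → ℝ) (π : S → A → ℝ) (w : W) (a : A) :
    ℝ := ∑ s, β w s * π s a

theorem auxK_nonneg {W S A : Type} [Fintype S] [Fintype A] (β : W → S → ℝ)
    (hβ : ∀ w, β w ∈ stdSimplex ℝ S) (π : S → A → ℝ) (hπ : ∀ s, π s ∈ stdSimplex ℝ A) (w : W)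
    (a : A) : 0 ≤ auxK β π w a :=
  Finset.sum_nonneg fun s _ => mul_nonneg ((hβ w).1 s) ((hπ s).1 a)

theorem auxK_sum {W S A : Type} [Fintype S] [Fintype A] (β : W → S → ℝ)
    (hβ : ∀ w, β w ∈ stdSimplex ℝ S) (π : S → A → ℝ) (hπ : ∀ s, π s ∈ stdSimplex ℝ A) (w : W) :
    ∑ a, auxK β π w a = 1 := by
  unfold auxK
  rw [Finset.sum_comm]
  simp only [← Finset.mul_sum, (hπ _).2, mul_one, (hβ w).2]

theorem auxK_update {W S A : Type} [Fintype S] [DecidableEq S] (β : W → S → ℝ) (π : S → A → ℝ)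
    (s : S) (f : A → ℝ) (w : W) (a : A) :
    auxK β (Function.update π s f) w a = auxK β π w a + β w s * (f a - π s a) := by
  unfold auxK
  rw [← sub_eq_iff_eq_add', ← Finset.sum_sub_distrib, Finset.sum_eq_single s]
  · simp; ring
  · intro s' _ h
    simp [h]
  · simp

structure AuxFeas {W S A : Type} [Fintype W] [Fintype S] [Fintype A] (α : W → A → W → ℝ)
    (β : W → S → ℝ) (p : W → ℝ) (π : S → A → ℝ) : Prop where
  hp : p ∈ stdSimplex ℝ W
  hπ : ∀ s, π s ∈ stdSimplex ℝ A
  st : ∀ w', ∑ w, ∑ a, p w * auxK β π w a * α w a w' = p w'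

noncomputable def auxN {W S A : Type} [Fintype W] [Fintype S] [Fintype A]
    (p : W → ℝ) (π : S → A → ℝ) : ℕ :=
  (Finset.univ.filter fun w => 0 < p w).card +
    (Finset.univ.filter fun sa : S × A => 0 < π sa.1 sa.2).card

noncomputable def auxR {W S A : Type} [Fintype W] [Fintype S] [Fintype A]
    (β : W → S → ℝ) (R : W → A → ℝ) (p : W → ℝ) (π : S → A → ℝ) : ℝ :=
  ∑ w, ∑ a, p w * auxK β π w a * R w a

theorem aux_step {W S A : Type} [Fintype W] [Fintype S] [Fintype A]
    (α : W → A → W → ℝ) (hα : ∀ w a, α w a ∈ stdSimplex ℝ W)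
    (β : W → S → ℝ) (hβ : ∀ w, β w ∈ stdSimplex ℝ S) (R : W → A → ℝ)
    (p : W → ℝ) (π : S → A → ℝ) (hF : AuxFeas α β p π) (s : S)
    (hs : ∀ w w', 0 < β w s → 0 < β w' s → w = w') (a b : A) (hab : a ≠ b)
    (ha : 0 < π s a) (hb : 0 < π s b) :
    ∃ p' π', AuxFeas α β p' π' ∧ auxR β R p π ≤ auxR β R p' π' ∧ auxN p' π' < auxN p π := by
  classical
  obtain ⟨hp, hπ, hst⟩ := hF
  by_cases hcase : ∀ w, p w * β w s = 0
  · -- case A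
    have hq : ∀ w c, p w * auxK β (Function.update π s (Pi.single a 1)) w c
        = p w * auxK β π w c := by
      intro w c
      rw [auxK_update, mul_add, ← mul_assoc, hcase w]; ring
    refine ⟨p, Function.update π s (Pi.single a 1), ⟨hp, ?_, ?_⟩, ?_, ?_⟩
    · intro s'
      by_cases h : s' = s
      · subst h; simpa using single_mem_stdSimplex ℝ a
      · simpa [h] using hπ s'
    · simpa only [hq] using hst
    · simp only [auxR, hq]; exact le_rfl
    · unfold auxN
      refine Nat.add_lt_add_left (Finset.card_lt_card ?_) _
      rw [Finset.ssubset_iff_of_subset]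
      · exact ⟨(s, b), by simpa using hb, by simp [hab.symm]⟩
      · rintro ⟨s', c⟩
        simp only [Finset.mem_filter, Finset.mem_univ, true_and]
        by_cases h : s' = s
        · subst h
          by_cases h' : c = a
          · subst h'; intro _; exact ha
          · simp [h']
        · simp [h]
  push Not at hcase
  obtain ⟨w0, hw0⟩ := hcase
  have hp0 : 0 < p w0 := lt_of_le_of_ne (hp.1 w0) (fun h => hw0 (by rw [← h, zero_mul]))
  have hβ0 : 0 < β w0 s := lt_of_le_of_ne ((hβ w0).1 s) (fun h => hw0 (by rw [← h, mul_zero]))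
  have hβn : ∀ w, w ≠ w0 → β w s = 0 := by
    intro w hw
    by_contra h
    exact hw (hs w w0 (lt_of_le_of_ne ((hβ w).1 s) (Ne.symm h)) hβ0)
  have hK0 := auxK_nonneg β hβ π hπ
  have hK1 := auxK_sum β hβ π hπ
  set K := auxK β π with hK
  have hKpos : ∀ c, 0 < π s c → 0 < K w0 c := by
    intro c hc
    refine Finset.sum_pos' (fun s _ => mul_nonneg ((hβ w0).1 s) ((hπ s).1 c))
      ⟨s, Finset.mem_univ _, mul_pos hβ0 hc⟩
  let P : W → W → ℝ := fun w w' => ∑ c, K w c * α w c w'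
  have hP0 : ∀ w w', 0 ≤ P w w' := fun w w' =>
    Finset.sum_nonneg fun c _ => mul_nonneg (hK0 w c) ((hα w c).1 w')
  have hP1 : ∀ w, ∑ w', P w w' = 1 := by
    intro w
    simp only [P]
    rw [Finset.sum_comm]
    simp only [← Finset.mul_sum, (hα _ _).2, mul_one, hK1]
  have hstP : ∀ w', ∑ w, p w * P w w' = p w' := by
    intro w'
    rw [← hst w']
    simp only [P, Finset.mul_sum, mul_assoc]
  let δ : A → ℝ := fun c => (if c = a then 1 else 0) - (if c = b then 1 else 0)
  have hδs : ∑ c, δ c = 0 := by simp [δ]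
  have hδ0 : ∀ c, π s c = 0 → δ c = 0 := by
    intro c hc
    have h1 : c ≠ a := by rintro rfl; linarith
    have h2 : c ≠ b := by rintro rfl; linarith
    simp [δ, h1, h2]
  have hδa : δ a = 1 := by simp [δ, hab]
  have hδb : δ b = -1 := by simp [δ, hab.symm]
  let z : W → ℝ := fun w' => ∑ c, β w0 s * δ c * α w0 c w'
  have hz1 : ∑ w, z w = 0 := by
    simp only [z]
    rw [Finset.sum_comm]
    simp only [← Finset.mul_sum, (hα _ _).2, mul_one, hδs, mul_zero]
  have hz : ∀ w, p w = 0 → z w = 0 := by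
    intro w' hw'
    have h1 := hstP w'
    rw [hw', Finset.sum_eq_zero_iff_of_nonneg (fun w _ => mul_nonneg (hp.1 w) (hP0 w w'))] at h1
    have h2 : P w0 w' = 0 := by
      rcases mul_eq_zero.1 (h1 w0 (Finset.mem_univ _)) with h | h
      · linarith
      · exact h
    simp only [P] at h2
    rw [Finset.sum_eq_zero_iff_of_nonneg
      (fun c _ => mul_nonneg (hK0 w0 c) ((hα w0 c).1 w'))] at h2
    apply Finset.sum_eq_zero
    intro c _
    by_cases hc : π s c = 0
    · rw [hδ0 c hc]; ring
    · have := hKpos c (lt_of_le_of_ne ((hπ s).1 c) (Ne.symm hc))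
      rcases mul_eq_zero.1 (h2 c (Finset.mem_univ _)) with h | h
      · linarith
      · rw [h, mul_zero]
  -- direction with nonnegative slope
  have hdir : ∃ (ξ : W → ℝ) (t : ℝ), (ξ ≠ 0 ∨ t ≠ 0) ∧ (∀ w, p w = 0 → ξ w = 0) ∧ ∑ w, ξ w = 0 ∧
      (∀ w', ∑ w, ξ w * P w w' + t * z w' = ξ w') ∧
      0 ≤ ∑ w, ∑ c, ξ w * K w c * R w c + t * ∑ c, β w0 s * δ c * R w0 c := by
    obtain ⟨ξ, t, h1, h2, h3, h4⟩ := aux_dir_s2 P hP0 hP1 p hp.1 hstP w0 hp0 z hz1 hz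
    rcases le_total 0 (∑ w, ∑ c, ξ w * K w c * R w c + t * ∑ c, β w0 s * δ c * R w0 c) with h | h
    · exact ⟨ξ, t, h1, h2, h3, h4, h⟩
    · refine ⟨-ξ, -t, by simpa using h1, fun w hw => by simp [h2 w hw], by simp [h3], ?_, ?_⟩
      · intro w'
        simp only [Pi.neg_apply, neg_mul, Finset.sum_neg_distrib]
        linarith [h4 w']
      · simp only [Pi.neg_apply, neg_mul, Finset.sum_neg_distrib]
        linarith
  obtain ⟨ξ, t, hne, hξ0, hξs, hξst, hslope⟩ := hdir
  -- hitting
  obtain ⟨ε, hε, hnn, hhit⟩ := aux_hit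
    (Sum.elim p (fun c => p w0 * π s c)) (Sum.elim ξ (fun c => ξ w0 * π s c + t * δ c))
    (by rintro (w | c)
        · exact hp.1 w
        · exact mul_nonneg hp0.le ((hπ s).1 c))
    (by rintro (w | c) h
        · exact hξ0 w h
        · have hc : π s c = 0 := by
            rcases mul_eq_zero.1 h with h | h
            · linarith
            · exact h
          simp [hc, hδ0 c hc])
    (by
      by_cases hξ : ξ = 0
      · have ht : t ≠ 0 := by
          rcases hne with h | h
          · exact absurd hξ h
          · exact h
        rcases lt_or_gt_of_ne ht with h | h
        · exact ⟨Sum.inr a, by simpa [hξ, hδa] using h⟩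
        · exact ⟨Sum.inr b, by simpa [hξ, hδb] using h⟩
      · by_contra hcon
        push Not at hcon
        have h0 : ∀ w ∈ Finset.univ, 0 ≤ ξ w := fun w _ => hcon (Sum.inl w)
        rw [Finset.sum_eq_zero_iff_of_nonneg h0] at hξs
        exact hξ (funext fun w => hξs w (Finset.mem_univ _)))
  let p' : W → ℝ := fun w => p w + ε * ξ w
  let y : A → ℝ := fun c => p' w0 * π s c + ε * t * δ c
  have hp'0 : ∀ w, 0 ≤ p' w := fun w => hnn (Sum.inl w)
  have hy0 : ∀ c, 0 ≤ y c := by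
    intro c
    have := hnn (Sum.inr c)
    simp only [Sum.elim_inr] at this
    simp only [y, p']
    linarith
  have hys : ∑ c, y c = p' w0 := by
    simp only [y, Finset.sum_add_distrib, ← Finset.mul_sum, (hπ s).2, hδs]; ring
  have hyz : ∀ c, π s c = 0 → y c = 0 := by
    intro c hc; simp [y, hc, hδ0 c hc]
  have hp's : ∑ w, p' w = 1 := by
    simp only [p', Finset.sum_add_distrib, ← Finset.mul_sum, hξs, hp.2]; ring
  have hsuppp : ∀ w, 0 < p' w → 0 < p w := by
    intro w h
    refine lt_of_le_of_ne (hp.1 w) (fun h0 => ?_)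
    simp only [p', ← h0, hξ0 w h0.symm] at h
    simp at h
  have hex : ∃ f : A → ℝ, f ∈ stdSimplex ℝ A ∧ (∀ c, p' w0 * f c = y c) ∧
      (∀ c, π s c = 0 → f c = 0) := by
    by_cases h : p' w0 = 0
    · refine ⟨π s, hπ s, ?_, fun c hc => hc⟩
      intro c
      rw [h, Finset.sum_eq_zero_iff_of_nonneg (fun c _ => hy0 c)] at hys
      rw [h, hys c (Finset.mem_univ _), zero_mul]
    · refine ⟨fun c => y c / p' w0, ⟨fun c => div_nonneg (hy0 c) (hp'0 w0), ?_⟩, ?_, ?_⟩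
      · rw [← Finset.sum_div, hys, div_self h]
      · intro c; field_simp
      · intro c hc; simp [hyz c hc]
  obtain ⟨f, hf, hfy, hfz⟩ := hex
  have hq : ∀ w c, p' w * auxK β (Function.update π s f) w c
      = p' w * K w c + if w = w0 then ε * t * (β w0 s * δ c) else 0 := by
    intro w c
    rw [auxK_update]
    split_ifs with h
    · subst h
      have := hfy c
      simp only [y] at this
      rw [mul_add, hK]
      linear_combination β w s * this
    · rw [hβn w h]; ring
  -- general functional
  have hgen : ∀ G : W → A → ℝ, ∑ w, ∑ c, p' w * auxK β (Function.update π s f) w c * G w c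
      = ∑ w, ∑ c, p w * K w c * G w c + ε * (∑ w, ∑ c, ξ w * K w c * G w c
        + t * ∑ c, β w0 s * δ c * G w0 c) := by
    intro G
    have h1 : ∀ w, ∑ c, p' w * auxK β (Function.update π s f) w c * G w c
        = ∑ c, p w * K w c * G w c + ε * ∑ c, ξ w * K w c * G w c
          + if w = w0 then ε * (t * ∑ c, β w0 s * δ c * G w0 c) else 0 := by
      intro w
      simp only [hq]
      split_ifs with h
      · subst h
        simp only [Finset.mul_sum, ← Finset.sum_add_distrib]
        refine Finset.sum_congr rfl fun c _ => ?_
        simp only [p']; ring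
      · simp only [Finset.mul_sum, ← Finset.sum_add_distrib, add_zero]
        refine Finset.sum_congr rfl fun c _ => ?_
        simp only [p']; ring
    simp only [h1, Finset.sum_add_distrib, ← Finset.mul_sum]
    simp
    ring
  refine ⟨p', Function.update π s f, ⟨⟨hp'0, hp's⟩, ?_, ?_⟩, ?_, ?_⟩
  · intro s'
    by_cases h : s' = s
    · subst h; simpa using hf
    · simpa [h] using hπ s'
  · intro w'
    rw [hgen (fun w c => α w c w'), hst w']
    have := hξst w'
    simp only [P, z, Finset.mul_sum] at this
    simp only [p', Finset.mul_sum]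
    rw [← this]
    simp only [mul_assoc, Finset.mul_sum, mul_add]
  · unfold auxR
    rw [hgen R]
    have := mul_nonneg hε.le hslope
    linarith
  · have hsub1 : (Finset.univ.filter fun w => 0 < p' w) ⊆ Finset.univ.filter fun w => 0 < p w := by
      intro w
      simpa using hsuppp w
    have hsub2 : (Finset.univ.filter fun sa : S × A => 0 < Function.update π s f sa.1 sa.2) ⊆
        Finset.univ.filter fun sa : S × A => 0 < π sa.1 sa.2 := by
      rintro ⟨s', c⟩
      simp only [Finset.mem_filter, Finset.mem_univ, true_and]
      by_cases h : s' = s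
      · subst h
        intro h
        refine lt_of_le_of_ne ((hπ s').1 c) (fun h0 => ?_)
        simp [hfz c h0.symm] at h
      · simp [h]
    have key1 : ∀ w, 0 < p w → p' w = 0 → auxN p' (Function.update π s f) < auxN p π := by
      intro w h1 h2
      refine Nat.add_lt_add_of_lt_of_le (Finset.card_lt_card ?_) (Finset.card_le_card hsub2)
      rw [Finset.ssubset_iff_of_subset hsub1]
      exact ⟨w, by simpa using h1, by simp [h2]⟩
    obtain ⟨i, hi1, hi2⟩ := hhit
    rcases i with w | c
    · exact key1 w hi1 hi2
    · by_cases h : p' w0 = 0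
      · exact key1 w0 hp0 h
      · refine Nat.add_lt_add_of_le_of_lt (Finset.card_le_card hsub1) (Finset.card_lt_card ?_)
        rw [Finset.ssubset_iff_of_subset hsub2]
        simp only [Sum.elim_inr] at hi1 hi2
        have hyc : y c = 0 := by simp only [y, p']; linarith
        have hfc : f c = 0 := by
          have := hfy c
          rw [hyc] at this
          exact (mul_eq_zero.1 this).resolve_left h
        refine ⟨(s, c), ?_, by simp [hfc]⟩
        simpa using pos_of_mul_pos_right hi1 hp0.le

theorem aux_opt {W S A : Type} [Fintype W] [Fintype S] [Fintype A]
    [Nonempty W] [Nonempty A]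
    (α : W → A → W → ℝ) (hα : ∀ w a, α w a ∈ stdSimplex ℝ W)
    (β : W → S → ℝ) (hβ : ∀ w, β w ∈ stdSimplex ℝ S) (R : W → A → ℝ) :
    ∃ p π, AuxFeas α β p π ∧ ∀ p' π', AuxFeas α β p' π' → auxR β R p' π' ≤ auxR β R p π := by
  classical
  have hc : IsCompact ((stdSimplex ℝ W ×ˢ Set.pi Set.univ fun _ : S => stdSimplex ℝ A) ∩
      {x : (W → ℝ) × (S → A → ℝ) |
        ∀ w', ∑ w, ∑ a, x.1 w * auxK β x.2 w a * α w a w' = x.1 w'}) := by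
    refine IsCompact.inter_right ((isCompact_stdSimplex ℝ W).prod
      (isCompact_univ_pi fun _ => isCompact_stdSimplex ℝ A)) ?_
    rw [Set.ofPred_forall]
    refine isClosed_iInter fun w' => isClosed_eq ?_ ?_
    · unfold auxK; fun_prop
    · fun_prop
  have hne : ((stdSimplex ℝ W ×ˢ Set.pi Set.univ fun _ : S => stdSimplex ℝ A) ∩
      {x : (W → ℝ) × (S → A → ℝ) |
        ∀ w', ∑ w, ∑ a, x.1 w * auxK β x.2 w a * α w a w' = x.1 w'}).Nonempty := by
    let π : S → A → ℝ := fun _ => Pi.single (Classical.arbitrary A) 1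
    have hπ : ∀ s, π s ∈ stdSimplex ℝ A := fun s => single_mem_stdSimplex ℝ _
    obtain ⟨p, hp, hst⟩ := aux_stat (fun w w' => ∑ c, auxK β π w c * α w c w')
      (fun w w' => Finset.sum_nonneg fun c _ =>
        mul_nonneg (auxK_nonneg β hβ π hπ w c) ((hα w c).1 w'))
      (by
        intro w
        rw [Finset.sum_comm]
        simp only [← Finset.mul_sum, (hα _ _).2, mul_one, auxK_sum β hβ π hπ])
    refine ⟨(p, π), ⟨hp, fun s _ => hπ s⟩, ?_⟩
    intro w'
    refine Eq.trans ?_ (hst w')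
    simp only [Finset.mul_sum, mul_assoc]
  obtain ⟨⟨p, π⟩, ⟨⟨h1, h2⟩, h3⟩, hmax⟩ := hc.exists_isMaxOn hne
    (f := fun x => auxR β R x.1 x.2) (by unfold auxR auxK; fun_prop)
  refine ⟨p, π, ⟨h1, fun s => h2 s trivial, h3⟩, ?_⟩
  intro p' π' h
  exact hmax (show (p', π') ∈ _ from ⟨⟨h.hp, fun s _ => h.hπ s⟩, h.st⟩)

/-- Every POMDP has a `|U|(|A|-1)`-stochastic optimal stationary policy
for the average reward, where `U` is the set of ambiguous sensor states. -/
theorem stmt_2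
    {W S A : Type} [Fintype W] [Fintype S] [Fintype A]
    [Nonempty W] [Nonempty S] [Nonempty A]
    (α : W → A → W → ℝ) (hα : ∀ w a, α w a ∈ stdSimplex ℝ W)
    (β : W → S → ℝ) (hβ : ∀ w, β w ∈ stdSimplex ℝ S)
    (R : W → A → ℝ)
    (U : Finset S)
    (hU : U = Finset.univ.filter fun s => 1 < (Finset.univ.filter fun w => 0 < β w s).card)
    (J : Set (W × A → ℝ))
    (hJ : J = {q | q ∈ stdSimplex ℝ (W × A) ∧
      ∀ w' : W, ∑ w : W, ∑ a : A, q (w, a) * α w a w' = ∑ a : A, q (w', a)})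
    (FJ : Set (W × A → ℝ))
    (hFJ : FJ = {q | q ∈ J ∧ ∃ p ∈ stdSimplex ℝ W, ∃ π : S → A → ℝ,
      (∀ s, π s ∈ stdSimplex ℝ A) ∧ ∀ w a, q (w, a) = p w * ∑ s : S, β w s * π s a}) :
    ∃ π : S → A → ℝ, (∀ s, π s ∈ stdSimplex ℝ A) ∧
      (Finset.univ.filter fun sa : S × A => 0 < π sa.1 sa.2).card
        ≤ Fintype.card S + U.card * (Fintype.card A - 1) ∧
      ∃ p ∈ stdSimplex ℝ W,
        (fun wa : W × A => p wa.1 * ∑ s : S, β wa.1 s * π s wa.2) ∈ J ∧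
        ∀ q ∈ FJ,
          ∑ wa : W × A, (p wa.1 * ∑ s : S, β wa.1 s * π s wa.2) * R wa.1 wa.2
            ≥ ∑ wa : W × A, q wa * R wa.1 wa.2 := by
  classical
  obtain ⟨p0, π0, hF0, hmax⟩ := aux_opt α hα β hβ R
  have hexN : ∃ n, ∃ p π, AuxFeas α β p π ∧ auxR β R p0 π0 ≤ auxR β R p π ∧ auxN p π = n :=
    ⟨_, p0, π0, hF0, le_rfl, rfl⟩
  obtain ⟨p, π, hF, hR, hN⟩ := Nat.find_spec hexN
  have hdet : ∀ s, s ∉ U → (Finset.univ.filter fun a => 0 < π s a).card ≤ 1 := by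
    intro s hsU
    by_contra hcon
    push Not at hcon
    obtain ⟨a, ha, b, hb, hab⟩ := Finset.one_lt_card.1 hcon
    have hs : ∀ w w', 0 < β w s → 0 < β w' s → w = w' := by
      intro w w' h h'
      by_contra hne
      apply hsU
      rw [hU]
      simp only [Finset.mem_filter, Finset.mem_univ, true_and]
      exact Finset.one_lt_card.2 ⟨w, by simpa using h, w', by simpa using h', hne⟩
    obtain ⟨p', π', hF', hR', hN'⟩ := aux_step α hα β hβ R p π hF s hs a b hab
      (by simpa using ha) (by simpa using hb)
    rw [hN] at hN'
    exact Nat.find_min hexN hN' ⟨p', π', hF', hR.trans hR', rfl⟩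
  have hK1 := auxK_sum β hβ π hF.hπ
  have hK0 := auxK_nonneg β hβ π hF.hπ
  refine ⟨π, hF.hπ, ?_, p, hF.hp, ?_, ?_⟩
  · have h1 : (Finset.univ.filter fun sa : S × A => 0 < π sa.1 sa.2).card
        = ∑ s, (Finset.univ.filter fun a => 0 < π s a).card := by
      simp only [Finset.card_filter, Fintype.sum_prod_type]
    rw [h1]
    have hA : 1 ≤ Fintype.card A := Fintype.card_pos
    calc ∑ s, (Finset.univ.filter fun a => 0 < π s a).card
        ≤ ∑ s, (1 + if s ∈ U then Fintype.card A - 1 else 0) := by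
          refine Finset.sum_le_sum fun s _ => ?_
          split_ifs with h
          · have := Finset.card_le_univ (Finset.univ.filter fun a => 0 < π s a)
            omega
          · exact hdet s h
      _ = Fintype.card S + U.card * (Fintype.card A - 1) := by
          rw [Finset.sum_add_distrib]
          simp
  · rw [hJ]
    refine ⟨⟨fun wa => mul_nonneg (hF.hp.1 _) (hK0 _ _), ?_⟩, ?_⟩
    · rw [Fintype.sum_prod_type]
      change ∑ w, ∑ a, p w * auxK β π w a = 1
      simp only [← Finset.mul_sum, hK1, mul_one, hF.hp.2]
    · intro w'
      change ∑ w, ∑ a, p w * auxK β π w a * α w a w' = ∑ a, p w' * auxK β π w' a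
      rw [hF.st, ← Finset.mul_sum, hK1, mul_one]
  · intro q hq
    rw [hFJ, hJ] at hq
    obtain ⟨⟨_, hqs⟩, p', hp', π', hπ', hq⟩ := hq
    have hq' : ∀ w a, q (w, a) = p' w * auxK β π' w a := hq
    have hF' : AuxFeas α β p' π' := by
      refine ⟨hp', hπ', fun w' => ?_⟩
      have := hqs w'
      simp only [hq'] at this
      rw [this, ← Finset.mul_sum, auxK_sum β hβ π' hπ', mul_one]
    have h := (hmax p' π' hF').trans hR
    rw [ge_iff_le, Fintype.sum_prod_type, Fintype.sum_prod_type]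
    simp only [hq']
    exact h
end

section
/- Let W, S, A be finite nonempty sets, let β be a Markov kernel from W to S, and let f_β: Δ_{S,A} → Δ_{W,A} be the map sending a kernel π to the kernel g(a|w) = Σ_{s∈S} β(s|w)·π(a|s). Let U := { s ∈ S : |{ w : β(s|w) > 1 ... }| } be precisely U := { s ∈ S : |{ w ∈ W : β(s|w) > 0 }| > 1 }. Then a kernel g from W to A lies in the image f_β(Δ_{S,A}) if and only if there exists a function θ: U → Δ_A such that for every w ∈ W there exists a function μ_w: S∖U → Δ_A with g(a|w) = Σ_{s∈U} β(s|w)·θ(s)(a) + Σ_{s∈S∖U} β(s|w)·μ_w(s)(a) for all a ∈ A. (Decomposition of the set of representable conditionals G into a union over θ of Cartesian products of convex sets.) -/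
/-- A kernel `g : W → Δ_A` is representable, i.e. lies in the image
`f_β(Δ_{S,A})`, iff there is a choice `θ` of action distributions on the ambiguous sensor
states `U` such that, for every world state `w`, `g(·|w)` is the `β`-mixture of the fixed
distributions `θ(s)` for `s ∈ U` and arbitrary (w-dependent) distributions on `S ∖ U`. -/
theorem stmt_3
    {W S A : Type} [Fintype W] [Fintype S] [Fintype A]
    [Nonempty W] [Nonempty S] [Nonempty A] [DecidableEq S]
    (β : W → S → ℝ) (hβ : ∀ w, β w ∈ stdSimplex ℝ S)
    (U : Finset S)
    (hU : U = Finset.univ.filter fun s => 1 < (Finset.univ.filter fun w => 0 < β w s).card)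
    (g : W → A → ℝ) (hg : ∀ w, g w ∈ stdSimplex ℝ A) :
    (∃ π : S → A → ℝ, (∀ s, π s ∈ stdSimplex ℝ A) ∧
        ∀ w a, g w a = ∑ s : S, β w s * π s a)
    ↔ (∃ θ : S → A → ℝ, (∀ s ∈ U, θ s ∈ stdSimplex ℝ A) ∧
        ∀ w : W, ∃ μ : S → A → ℝ, (∀ s ∉ U, μ s ∈ stdSimplex ℝ A) ∧
          ∀ a : A, g w a = ∑ s ∈ U, β w s * θ s a + ∑ s ∈ Uᶜ, β w s * μ s a) := by
  classical
  constructor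
  · rintro ⟨π, hπ, h⟩
    refine ⟨π, fun s _ => hπ s, fun w => ⟨π, fun s _ => hπ s, fun a => ?_⟩⟩
    rw [h, Finset.sum_add_sum_compl]
  · rintro ⟨θ, hθ, h⟩
    choose μ hμ hg' using h
    have key : ∀ s, ∃ v : W, s ∉ U → ∀ w, 0 < β w s → w = v := by
      intro s
      by_cases hs : ∃ v, 0 < β v s
      · obtain ⟨v, hv⟩ := hs
        refine ⟨v, fun hsU w hw => ?_⟩
        have hc : (Finset.univ.filter fun w => 0 < β w s).card ≤ 1 := by
          by_contra hc
          apply hsU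
          rw [hU, Finset.mem_filter]
          exact ⟨Finset.mem_univ _, not_le.mp hc⟩
        exact Finset.card_le_one.mp hc w (by simpa using hw) v (by simpa using hv)
      · exact ⟨Classical.arbitrary W, fun _ w hw => absurd ⟨w, hw⟩ hs⟩
    choose v hv using key
    refine ⟨fun s => if s ∈ U then θ s else μ (v s) s, fun s => ?_, fun w a => ?_⟩
    · by_cases hs : s ∈ U
      · simpa [hs] using hθ s hs
      · simpa [hs] using hμ (v s) s hs
    · rw [hg' w a, ← Finset.sum_add_sum_compl U]
      congr 1
      · exact Finset.sum_congr rfl fun s hs => by simp [hs]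
      · refine Finset.sum_congr rfl fun s hs => ?_
        have hs' : s ∉ U := Finset.mem_compl.mp hs
        rcases ((hβ w).1 s).lt_or_eq with hp | hp
        · have := hv s hs' w hp
          simp [hs', ← this]
        · simp [← hp]
end

section
/- Let W, S, A be finite nonempty sets, let β be a Markov kernel from W to S, and let U := { s ∈ S : |{ w ∈ W : β(s|w) > 0 }| > 1 }. For θ: U → Δ_A, let G_θ := { g ∈ Δ_{W,A} : for every w ∈ W there exists μ_w: S∖U → Δ_A with g(a|w) = Σ_{s∈U} β(s|w)·θ(s)(a) + Σ_{s∈S∖U} β(s|w)·μ_w(s)(a) for all a }. Then for every θ and every extreme point g of the convex set G_θ, there exists a Markov kernel π from S to A such that Σ_s β(s|w)·π(a|s) = g(a|w) for all w, a, with π(·|s) = θ(s) for s ∈ U and π(·|s) a point mass (deterministic) for every s ∈ S∖U; in particular π has at most |S| + |U|·(|A|−1) nonzero entries π(a|s). -/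
/-- Every extreme point of the convex piece `G_θ` of the set of
representable conditionals is realized by a policy `π` that agrees with `θ` on the
ambiguous sensor states `U` and is deterministic on `S ∖ U`; in particular `π` has at
most `|S| + |U|·(|A|−1)` nonzero entries. -/
theorem stmt_4
    {W S A : Type} [Fintype W] [Fintype S] [Fintype A]
    [Nonempty W] [Nonempty S] [Nonempty A] [DecidableEq S] [DecidableEq A]
    (β : W → S → ℝ) (hβ : ∀ w, β w ∈ stdSimplex ℝ S)
    (U : Finset S)
    (hU : U = Finset.univ.filter fun s => 1 < (Finset.univ.filter fun w => 0 < β w s).card)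
    (θ : S → A → ℝ) (hθ : ∀ s ∈ U, θ s ∈ stdSimplex ℝ A)
    (Gθ : Set (W → A → ℝ))
    (hGθ : Gθ = {g | (∀ w, g w ∈ stdSimplex ℝ A) ∧
      ∀ w : W, ∃ μ : S → A → ℝ, (∀ s ∉ U, μ s ∈ stdSimplex ℝ A) ∧
        ∀ a : A, g w a = ∑ s ∈ U, β w s * θ s a + ∑ s ∈ Uᶜ, β w s * μ s a})
    (g : W → A → ℝ) (hg : g ∈ Gθ.extremePoints ℝ) :
    ∃ π : S → A → ℝ, (∀ s, π s ∈ stdSimplex ℝ A) ∧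
      (∀ w a, ∑ s : S, β w s * π s a = g w a) ∧
      (∀ s ∈ U, π s = θ s) ∧
      (∀ s ∉ U, ∃ a : A, π s = fun a' => if a' = a then (1 : ℝ) else 0) ∧
      (Finset.univ.filter fun sa : S × A => 0 < π sa.1 sa.2).card
        ≤ Fintype.card S + U.card * (Fintype.card A - 1) := by
  classical
  have key : ∀ w : W, ∃ a : A, ∀ a' : A, g w a' = ∑ s ∈ U, β w s * θ s a' +
      (∑ s ∈ Uᶜ, β w s) * (if a' = a then (1 : ℝ) else 0) := by
    intro w
    have hgG := hg.1
    rw [hGθ] at hgG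
    obtain ⟨hg1, hg2⟩ := hgG
    obtain ⟨μ, hμ, hgμ⟩ := hg2 w
    set m := ∑ s ∈ Uᶜ, β w s with hm
    have hm0 : 0 ≤ m := Finset.sum_nonneg fun s _ => (hβ w).1 s
    rcases hm0.eq_or_lt with h0 | hpos
    · refine ⟨Classical.arbitrary A, fun a' => ?_⟩
      have hz : ∀ s ∈ Uᶜ, β w s = 0 :=
        (Finset.sum_eq_zero_iff_of_nonneg fun s _ => (hβ w).1 s).1 (hm.symm.trans h0.symm)
      rw [hgμ a', ← h0, zero_mul]
      congr 1
      exact Finset.sum_eq_zero fun s hs => by rw [hz s hs, zero_mul]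
    · let F : (A → ℝ) → W → A → ℝ := fun q =>
        Function.update g w (fun a => ∑ s ∈ U, β w s * θ s a + m * q a)
      let p : A → ℝ := fun a => (∑ s ∈ Uᶜ, β w s * μ s a) / m
      have hp : p ∈ stdSimplex ℝ A := by
        refine ⟨fun a => div_nonneg (Finset.sum_nonneg fun s hs => mul_nonneg ((hβ w).1 s)
          ((hμ s (Finset.mem_compl.1 hs)).1 a)) hm0, ?_⟩
        change ∑ a, (∑ s ∈ Uᶜ, β w s * μ s a) / m = 1
        rw [← Finset.sum_div, Finset.sum_comm]
        have : ∑ s ∈ Uᶜ, ∑ a, β w s * μ s a = m := by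
          rw [hm]
          refine Finset.sum_congr rfl fun s hs => ?_
          rw [← Finset.mul_sum, (hμ s (Finset.mem_compl.1 hs)).2, mul_one]
        rw [this, div_self hpos.ne']
      have hFp : F p = g := by
        have : (fun a => ∑ s ∈ U, β w s * θ s a + m * p a) = g w := by
          funext a
          rw [hgμ a, mul_div_cancel₀ _ hpos.ne']
        change Function.update g w (fun a => ∑ s ∈ U, β w s * θ s a + m * p a) = g
        rw [this, Function.update_eq_self]
      have hFG : ∀ q ∈ stdSimplex ℝ A, F q ∈ Gθ := by
        intro q hq
        rw [hGθ]
        refine ⟨fun w' => ?_, fun w' => ?_⟩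
        · by_cases h : w' = w
          · subst h
            simp only [F, Function.update_self]
            refine ⟨fun a => add_nonneg (Finset.sum_nonneg fun s hs => mul_nonneg ((hβ _).1 s)
              ((hθ s hs).1 a)) (mul_nonneg hm0 (hq.1 a)), ?_⟩
            rw [Finset.sum_add_distrib, ← Finset.mul_sum, hq.2, mul_one, Finset.sum_comm]
            have : ∑ s ∈ U, ∑ a, β w' s * θ s a = ∑ s ∈ U, β w' s := by
              refine Finset.sum_congr rfl fun s hs => ?_
              rw [← Finset.mul_sum, (hθ s hs).2, mul_one]
            rw [this, hm, Finset.sum_add_sum_compl]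
            exact (hβ _).2
          · simp only [F, Function.update_of_ne h]
            exact hg1 w'
        · by_cases h : w' = w
          · subst h
            refine ⟨fun _ => q, fun _ _ => hq, fun a => ?_⟩
            simp only [F, Function.update_self]
            rw [hm, Finset.sum_mul]
          · simp only [F, Function.update_of_ne h]
            exact hg2 w'
      have hinj : ∀ q q', F q = F q' → q = q' := by
        intro q q' h
        funext a
        have := congrFun (congrFun h w) a
        simp only [F, Function.update_self] at this
        exact mul_left_cancel₀ hpos.ne' (add_left_cancel this)
      have hext : p ∈ (stdSimplex ℝ A).extremePoints ℝ := by
        refine ⟨hp, ?_⟩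
        rintro x hx y hy ⟨s, t, hs, ht, hst, hxy⟩
        have hseg : g ∈ openSegment ℝ (F x) (F y) := by
          refine ⟨s, t, hs, ht, hst, ?_⟩
          rw [← hFp, ← hxy]
          funext w' a
          by_cases h : w' = w
          · subst h
            simp only [F, Pi.add_apply, Pi.smul_apply, Function.update_self, smul_eq_mul]
            linear_combination (∑ s ∈ U, β w' s * θ s a) * hst
          · simp only [F, Pi.add_apply, Pi.smul_apply, Function.update_of_ne h, smul_eq_mul]
            linear_combination (g w' a) * hst
        have h1 := hg.2 (hFG x hx) (hFG y hy) hseg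
        exact hinj _ _ (by rw [hFp]; first | exact h1 | exact h1.1)
      rw [← convexHull_basis_eq_stdSimplex] at hext
      obtain ⟨a, ha⟩ := extremePoints_convexHull_subset hext
      refine ⟨a, fun a' => ?_⟩
      have h2 : p a' = if a' = a then 1 else 0 := by
        rw [← ha]; simp [eq_comm]
      rw [← h2, hgμ a', mul_div_cancel₀ _ hpos.ne']
  choose α hα using key
  have huniq : ∀ s ∉ U, ∀ w w', 0 < β w s → 0 < β w' s → w = w' := by
    intro s hs w w' h h'
    rw [hU] at hs
    simp only [Finset.mem_filter, Finset.mem_univ, true_and, not_lt] at hs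
    exact Finset.card_le_one.1 hs w (by simpa using h) w' (by simpa using h')
  have hb : ∀ s, ∃ a : A, s ∉ U → ∀ w, 0 < β w s → a = α w := by
    intro s
    by_cases h : ∃ w, 0 < β w s
    · obtain ⟨w, hw⟩ := h
      exact ⟨α w, fun hs w' hw' => by rw [huniq s hs w w' hw hw']⟩
    · exact ⟨Classical.arbitrary A, fun _ w hw => (h ⟨w, hw⟩).elim⟩
  choose b hb using hb
  refine ⟨fun s => if s ∈ U then θ s else fun a' => if a' = b s then 1 else 0,
    ?_, ?_, ?_, ?_, ?_⟩
  · intro s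
    by_cases hs : s ∈ U
    · simpa [hs] using hθ s hs
    · simp only [hs, if_false]
      refine ⟨fun a => ?_, by simp⟩
      dsimp only
      split_ifs <;> norm_num
  · intro w a
    rw [hα w a, ← Finset.sum_add_sum_compl U, Finset.sum_mul]
    congr 1
    · exact Finset.sum_congr rfl fun s hs => by simp only [hs, if_true]
    · refine Finset.sum_congr rfl fun s hs => ?_
      have hs' := Finset.mem_compl.1 hs
      simp only [hs', if_false]
      rcases ((hβ w).1 s).eq_or_lt with h | h
      · rw [← h]; simp
      · rw [hb s hs' w h]
  · intro s hs
    simp [hs]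
  · intro s hs
    exact ⟨b s, by simp [hs]⟩
  · set π : S → A → ℝ := fun s => if s ∈ U then θ s else fun a' => if a' = b s then 1 else 0
      with hπ
    have hcA : 0 < Fintype.card A := Fintype.card_pos
    have hone : ∀ s, (Finset.univ.filter fun a => 0 < π s a).card ≤
        1 + if s ∈ U then Fintype.card A - 1 else 0 := by
      intro s
      by_cases hs : s ∈ U
      · have := Finset.card_le_univ (Finset.univ.filter fun a => 0 < π s a)
        simp only [hs, if_true]
        omega
      · simp only [hs, if_false, add_zero]
        refine Finset.card_le_one.2 fun x hx y hy => ?_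
        have h1 : ∀ z, 0 < π s z → z = b s := by
          intro z hz
          by_contra hne
          simp [hπ, hs, hne] at hz
        rw [h1 x (Finset.mem_filter.1 hx).2, h1 y (Finset.mem_filter.1 hy).2]
    calc (Finset.univ.filter fun sa : S × A => 0 < π sa.1 sa.2).card
        = ∑ s, (Finset.univ.filter fun a => 0 < π s a).card := by
          simp only [Finset.card_filter]
          rw [Fintype.sum_prod_type]
      _ ≤ ∑ s : S, (1 + if s ∈ U then Fintype.card A - 1 else 0) :=
          Finset.sum_le_sum fun s _ => hone s
      _ = _ := by
          rw [Finset.sum_add_distrib]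
          simp
end

section
/- Let W and A be finite nonempty sets and let V ⊆ W. Let P ⊆ Δ_W be a convex set such that every p ∈ P has support contained in V. Let G be a set of Markov kernels from W to A such that the restriction set G|_V := { (g(·|w))_{w∈V} : g ∈ G } equals a Cartesian product ∏_{w∈V} G_w with each G_w ⊆ Δ_A convex. Then the set P ∗ G := { q ∈ Δ_{W×A} : q(w,a) = p(w)·g(a|w) for some p ∈ P, g ∈ G } is a convex subset of Δ_{W×A}. -/
/-- If `P ⊆ Δ_W` is convex with supports in `V` and the restriction of a
set of kernels `G` to `V` is a Cartesian product of convex sets, then the set of joint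
distributions `P ∗ G` is a convex subset of the simplex `Δ_{W×A}`. -/
theorem stmt_5
    {W A : Type} [Fintype W] [Fintype A] [Nonempty W] [Nonempty A]
    (V : Set W)
    (P : Set (W → ℝ)) (hPconv : Convex ℝ P) (hPsub : P ⊆ stdSimplex ℝ W)
    (hPsupp : ∀ p ∈ P, ∀ w : W, 0 < p w → w ∈ V)
    (G : Set (W → A → ℝ)) (hGker : ∀ g ∈ G, ∀ w, g w ∈ stdSimplex ℝ A)
    (Gw : V → Set (A → ℝ))
    (hGwconv : ∀ w : V, Convex ℝ (Gw w)) (hGwsub : ∀ w : V, Gw w ⊆ stdSimplex ℝ A)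
    (hprod : {h : V → A → ℝ | ∃ g ∈ G, ∀ w : V, h w = g w.1} = Set.univ.pi Gw) :
    Convex ℝ {q : W × A → ℝ | ∃ p ∈ P, ∃ g ∈ G, ∀ w a, q (w, a) = p w * g w a} ∧
    {q : W × A → ℝ | ∃ p ∈ P, ∃ g ∈ G, ∀ w a, q (w, a) = p w * g w a}
      ⊆ stdSimplex ℝ (W × A) := by
  have hmem : ∀ g ∈ G, ∀ w : V, g w.1 ∈ Gw w := by
    intro g hg w
    have h : (fun w : V => g w.1) ∈ Set.univ.pi Gw := by
      rw [← hprod]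
      exact ⟨g, hg, fun _ => rfl⟩
    exact h w (Set.mem_univ _)
  constructor
  · rintro q₁ ⟨p₁, hp₁, g₁, hg₁, h₁⟩ q₂ ⟨p₂, hp₂, g₂, hg₂, h₂⟩ s t hs ht hst
    have key : ∀ w : V, ∃ h ∈ Gw w, ∀ a,
        s * (p₁ w.1 * g₁ w.1 a) + t * (p₂ w.1 * g₂ w.1 a)
          = (s * p₁ w.1 + t * p₂ w.1) * h a := by
      intro w
      have n₁ : 0 ≤ s * p₁ w.1 := mul_nonneg hs ((hPsub hp₁).1 _)
      have n₂ : 0 ≤ t * p₂ w.1 := mul_nonneg ht ((hPsub hp₂).1 _)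
      rcases (add_nonneg n₁ n₂).eq_or_lt with h0 | hpos
      · have e₁ : s * p₁ w.1 = 0 := by linarith
        have e₂ : t * p₂ w.1 = 0 := by linarith
        refine ⟨g₁ w.1, hmem g₁ hg₁ w, fun a => ?_⟩
        rw [← mul_assoc, ← mul_assoc, e₁, e₂]
        ring
      · refine ⟨_, hGwconv w (hmem g₁ hg₁ w) (hmem g₂ hg₂ w)
          (div_nonneg n₁ hpos.le) (div_nonneg n₂ hpos.le)
          (by rw [← add_div, div_self hpos.ne']), fun a => ?_⟩
        simp only [Pi.add_apply, Pi.smul_apply, smul_eq_mul]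
        have := hpos.ne'
        field_simp
    choose h hh he using key
    have hin : h ∈ {h : V → A → ℝ | ∃ g ∈ G, ∀ w : V, h w = g w.1} := by
      rw [hprod]
      exact fun w _ => hh w
    obtain ⟨g, hg, hgh⟩ := hin
    refine ⟨_, hPconv hp₁ hp₂ hs ht hst, g, hg, fun w a => ?_⟩
    simp only [Pi.add_apply, Pi.smul_apply, smul_eq_mul, h₁, h₂]
    by_cases hw : w ∈ V
    · have := he ⟨w, hw⟩ a
      rw [hgh] at this
      exact this
    · have z : ∀ p ∈ P, p w = 0 := fun p hp =>
        le_antisymm (not_lt.1 fun hlt => hw (hPsupp p hp w hlt)) ((hPsub hp).1 w)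
      rw [z p₁ hp₁, z p₂ hp₂]
      ring
  · rintro q ⟨p, hp, g, hg, h⟩
    refine ⟨?_, ?_⟩
    · rintro ⟨w, a⟩
      rw [h]
      exact mul_nonneg ((hPsub hp).1 w) ((hGker g hg w).1 a)
    · rw [Fintype.sum_prod_type]
      simp only [h, ← Finset.mul_sum, (hGker g hg _).2, mul_one]
      exact (hPsub hp).2
end

section
/- Let K ≥ 1 and let t_1, …, t_K ∈ (0,1]. For c > 0 define π_1(c), …, π_K(c) recursively by π_1(c) = c and π_i(c) = π_{i−1}(c) + c·∏_{j=1}^{i−1} t_j·π_j(c) for i = 2, …, K. Then there exists exactly one c > 0 such that π_1(c) + π_2(c) + ⋯ + π_K(c) = 1. -/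
/-- For the recursion `π_1(c) = c`,
`π_i(c) = π_{i−1}(c) + c·∏_{j=1}^{i−1} t_j·π_j(c)`, there is exactly one `c > 0` with
`π_1(c) + ⋯ + π_K(c) = 1`. -/
theorem stmt_10
    (K : ℕ) (hK : 1 ≤ K) (t : ℕ → ℝ)
    (ht : ∀ i ∈ Finset.Icc 1 K, t i ∈ Set.Ioc (0 : ℝ) 1)
    (π : ℝ → ℕ → ℝ)
    (hπ1 : ∀ c : ℝ, π c 1 = c)
    (hπrec : ∀ c : ℝ, ∀ i, 2 ≤ i → i ≤ K →
      π c i = π c (i - 1) + c * ∏ j ∈ Finset.Icc 1 (i - 1), t j * π c j) :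
    ∃! c : ℝ, 0 < c ∧ ∑ i ∈ Finset.Icc 1 K, π c i = 1 := by
  have key : ∀ i, 1 ≤ i → i ≤ K → Continuous (fun c => π c i) ∧ π 0 i = 0 ∧
      (∀ a, 0 ≤ a → 0 ≤ π a i) ∧ (∀ a b, 0 ≤ a → a < b → π a i < π b i) := by
    intro i
    induction i using Nat.strong_induction_on with
    | _ i ih =>
      intro h1 hi
      rcases Nat.lt_or_ge i 2 with h2 | h2
      · obtain rfl : i = 1 := by omega
        simp only [hπ1]
        exact ⟨continuous_id, trivial, fun a h => h, fun a b _ h => h⟩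
      · have hr := fun c => hπrec c i h2 hi
        obtain ⟨p1, p2, p3, p4⟩ := ih (i - 1) (by omega) (by omega) (by omega)
        have hj : ∀ j ∈ Finset.Icc 1 (i - 1), 0 ≤ t j ∧ Continuous (fun c => π c j) ∧ π 0 j = 0 ∧
            (∀ a, 0 ≤ a → 0 ≤ π a j) ∧ (∀ a b, 0 ≤ a → a < b → π a j < π b j) := by
          intro j hj
          rw [Finset.mem_Icc] at hj
          exact ⟨(ht j (Finset.mem_Icc.2 ⟨hj.1, by omega⟩)).1.le,
            ih j (by omega) hj.1 (by omega)⟩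
        have hn : ∀ a, 0 ≤ a → 0 ≤ ∏ j ∈ Finset.Icc 1 (i - 1), t j * π a j := fun a ha =>
          Finset.prod_nonneg fun j h => mul_nonneg (hj j h).1 ((hj j h).2.2.2.1 a ha)
        refine ⟨?_, ?_, ?_, ?_⟩
        · simp only [hr]
          exact p1.add (continuous_id.mul (continuous_finset_prod _ fun j h =>
            continuous_const.mul (hj j h).2.1))
        · rw [hr, p2]; simp
        · intro a ha
          rw [hr]
          exact add_nonneg (p3 a ha) (mul_nonneg ha (hn a ha))
        · intro a b ha hab
          rw [hr a, hr b]
          refine add_lt_add_of_lt_of_le (p4 a b ha hab) ?_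
          refine mul_le_mul hab.le ?_ (hn a ha) (ha.trans hab.le)
          refine Finset.prod_le_prod
            (fun j h => mul_nonneg (hj j h).1 ((hj j h).2.2.2.1 a ha)) fun j h => ?_
          exact mul_le_mul_of_nonneg_left ((hj j h).2.2.2.2 a b ha hab).le (hj j h).1
  have key' : ∀ i ∈ Finset.Icc 1 K, _ := fun i hi =>
    key i (Finset.mem_Icc.1 hi).1 (Finset.mem_Icc.1 hi).2
  have hmem : 1 ∈ Finset.Icc 1 K := Finset.mem_Icc.2 ⟨le_rfl, hK⟩
  have hmono : ∀ a b, 0 ≤ a → a < b →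
      ∑ i ∈ Finset.Icc 1 K, π a i < ∑ i ∈ Finset.Icc 1 K, π b i := fun a b ha hab =>
    Finset.sum_lt_sum_of_nonempty ⟨1, hmem⟩ fun i hi => (key' i hi).2.2.2 a b ha hab
  have hcont : Continuous (fun c => ∑ i ∈ Finset.Icc 1 K, π c i) :=
    continuous_finset_sum _ fun i hi => (key' i hi).1
  have h0 : ∑ i ∈ Finset.Icc 1 K, π 0 i = 0 :=
    Finset.sum_eq_zero fun i hi => (key' i hi).2.1
  have h1 : 1 ≤ ∑ i ∈ Finset.Icc 1 K, π 1 i := by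
    have := Finset.single_le_sum (f := fun i => π 1 i)
      (fun i hi => (key' i hi).2.2.1 1 zero_le_one) hmem
    simpa only [hπ1] using this
  obtain ⟨c, ⟨hc0, _⟩, hc⟩ := intermediate_value_Icc (zero_le_one (α := ℝ)) hcont.continuousOn
    (show (1 : ℝ) ∈ Set.Icc _ _ from ⟨by simp only [h0]; exact zero_le_one, h1⟩)
  simp only at hc
  refine ⟨c, ⟨lt_of_le_of_ne hc0 ?_, hc⟩, ?_⟩
  · rintro rfl
    rw [h0] at hc
    exact zero_ne_one hc
  · rintro d ⟨hd, hd1⟩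
    rcases lt_trichotomy d c with h | h | h
    · have := hmono d c hd.le h
      linarith
    · exact h
    · have := hmono c d hc0 h
      linarith
end

section
/- Let K ≥ 1. Define f on the simplex Δ_K := { π ∈ ℝ^K : π_i ≥ 0, Σ_{i=1}^K π_i = 1 } by f(π) = (∏_{i=1}^K π_i) / (1 + Σ_{j=1}^K ∏_{i=1}^j π_i). For c > 0 define π(c) ∈ ℝ^K recursively by π_1(c) = c and π_i(c) = π_{i−1}(c) + c·∏_{j=1}^{i−1} π_j(c) for i = 2, …, K, and let c* be the unique c > 0 with Σ_i π_i(c) = 1. Then π(c*) ∈ Δ_K and f(π(c*)) ≥ f(π) for every π ∈ Δ_K; moreover π(c*) is the unique maximizer of f over Δ_K. -/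
theorem aux_tail {s : Finset ℕ} (x : ℕ → ℝ) (hx : ∀ i ∈ s, 0 < x i) :
    1 + ∑ i ∈ s, (1 - x i) ≤ ∏ i ∈ s, (x i)⁻¹ := by
  have h1 : Real.exp (∑ i ∈ s, (1 - x i)) ≤ ∏ i ∈ s, (x i)⁻¹ := by
    rw [Real.exp_sum]
    apply Finset.prod_le_prod
    · intro i _
      positivity
    · intro i hi
      have h := Real.add_one_le_exp (x i - 1)
      have h2 : Real.exp (1 - x i) = (Real.exp (x i - 1))⁻¹ := by
        rw [← Real.exp_neg]; congr 1; ring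
      rw [h2]
      exact inv_anti₀ (hx i hi) (by linarith)
  have h2 := Real.add_one_le_exp (∑ i ∈ s, (1 - x i))
  linarith

theorem aux_tail_strict {s : Finset ℕ} (x : ℕ → ℝ) (hx : ∀ i ∈ s, 0 < x i)
    (hne : ∃ i ∈ s, x i ≠ 1) :
    1 + ∑ i ∈ s, (1 - x i) < ∏ i ∈ s, (x i)⁻¹ := by
  have h1 : Real.exp (∑ i ∈ s, (1 - x i)) < ∏ i ∈ s, (x i)⁻¹ := by
    rw [Real.exp_sum]
    have h2 : ∀ i, Real.exp (1 - x i) = (Real.exp (x i - 1))⁻¹ := by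
      intro i
      rw [← Real.exp_neg]; congr 1; ring
    apply Finset.prod_lt_prod
    · intro i _
      positivity
    · intro i hi
      have h := Real.add_one_le_exp (x i - 1)
      rw [h2]
      exact inv_anti₀ (hx i hi) (by linarith)
    · obtain ⟨i, hi, hxi⟩ := hne
      refine ⟨i, hi, ?_⟩
      have h := Real.add_one_lt_exp (sub_ne_zero.mpr hxi)
      rw [h2]
      exact inv_strictAnti₀ (hx i hi) (by linarith)
  have h2 := Real.add_one_le_exp (∑ i ∈ s, (1 - x i))
  linarith

theorem aux_split (p : ℕ → ℝ) (j K : ℕ) (h : j ≤ K) :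
    ∏ i ∈ Finset.Icc 1 K, p i = (∏ i ∈ Finset.Icc 1 j, p i) * ∏ i ∈ Finset.Ioc j K, p i := by
  induction K, h using Nat.le_induction with
  | base => simp
  | succ n hn ih =>
    rw [Finset.prod_Icc_succ_top (by omega), ih, ← Finset.insert_Ioc_right_eq_Ioc_add_one hn,
      Finset.prod_insert (by simp)]
    ring

theorem aux_den (p : ℕ → ℝ) (K : ℕ) :
    1 + ∑ j ∈ Finset.Icc 1 K, ∏ i ∈ Finset.Icc 1 j, p i
      = ∑ j ∈ Finset.range (K + 1), ∏ i ∈ Finset.Icc 1 j, p i := by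
  induction K with
  | zero => simp
  | succ n ih =>
    rw [Finset.sum_Icc_succ_top (by omega), Finset.sum_range_succ, ← ih]
    ring

theorem aux_main (K : ℕ) (p ρ : ℕ → ℝ) (c : ℝ) (hc : 0 < c)
    (hp : ∀ i ∈ Finset.Icc 1 K, 0 < p i)
    (hrec : ∀ i ∈ Finset.Icc 1 K,
      p i = c * ∑ j ∈ Finset.range i, ∏ k ∈ Finset.Icc 1 j, p k)
    (hpsum : ∑ i ∈ Finset.Icc 1 K, p i = 1)
    (hρ : ∀ i ∈ Finset.Icc 1 K, 0 < ρ i)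
    (hρsum : ∑ i ∈ Finset.Icc 1 K, ρ i = 1)
    (hne : ∃ i ∈ Finset.Icc 1 K, ρ i ≠ p i) :
    (∏ i ∈ Finset.Icc 1 K, ρ i) / (∑ j ∈ Finset.range (K + 1), ∏ i ∈ Finset.Icc 1 j, ρ i) <
    (∏ i ∈ Finset.Icc 1 K, p i) / (∑ j ∈ Finset.range (K + 1), ∏ i ∈ Finset.Icc 1 j, p i) := by
  have hPpos : ∀ q : ℕ → ℝ, (∀ i ∈ Finset.Icc 1 K, 0 < q i) → ∀ j ∈ Finset.range (K + 1),
      0 < ∏ i ∈ Finset.Icc 1 j, q i := by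
    intro q hq j hj
    apply Finset.prod_pos
    intro i hi
    apply hq
    simp only [Finset.mem_Icc, Finset.mem_range] at *
    omega
  have hDpos : ∀ q : ℕ → ℝ, (∀ i ∈ Finset.Icc 1 K, 0 < q i) →
      0 < ∑ j ∈ Finset.range (K + 1), ∏ i ∈ Finset.Icc 1 j, q i := by
    intro q hq
    exact Finset.sum_pos (hPpos q hq) ⟨0, by simp⟩
  have hKm : K ∈ Finset.range (K + 1) := by simp
  have hQK := hPpos ρ hρ K hKm
  have hPK := hPpos p hp K hKm
  -- term identity
  have hterm : ∀ j ∈ Finset.range (K + 1),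
      (∏ i ∈ Finset.Icc 1 j, ρ i) * ((∏ i ∈ Finset.Icc 1 K, p i) / ∏ i ∈ Finset.Icc 1 K, ρ i)
      = (∏ i ∈ Finset.Icc 1 j, p i) * ∏ i ∈ Finset.Ioc j K, (ρ i / p i)⁻¹ := by
    intro j hj
    have hjK : j ≤ K := by simp at hj; omega
    have h1 := hPpos ρ hρ j hj
    have h3 : ∏ i ∈ Finset.Ioc j K, ρ i ≠ 0 := by
      intro h0
      rw [aux_split ρ j K hjK, h0] at hQK
      simp at hQK
    rw [aux_split p j K hjK, aux_split ρ j K hjK]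
    simp only [inv_div, Finset.prod_div_distrib]
    field_simp
  have hsum0 : ∑ j ∈ Finset.range (K + 1), (∏ i ∈ Finset.Icc 1 j, p i) *
      (1 + ∑ i ∈ Finset.Ioc j K, (1 - ρ i / p i))
      = ∑ j ∈ Finset.range (K + 1), ∏ i ∈ Finset.Icc 1 j, p i := by
    simp only [mul_add, mul_one, Finset.sum_add_distrib, Finset.mul_sum]
    rw [Finset.sum_comm' (t' := Finset.Icc 1 K) (s' := fun i => Finset.range i)
      (by intro a b; simp only [Finset.mem_range, Finset.mem_Ioc, Finset.mem_Icc]; omega)]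
    have : ∑ i ∈ Finset.Icc 1 K, ∑ j ∈ Finset.range i,
        (∏ k ∈ Finset.Icc 1 j, p k) * (1 - ρ i / p i) = ∑ i ∈ Finset.Icc 1 K, (p i - ρ i) / c := by
      apply Finset.sum_congr rfl
      intro i hi
      rw [← Finset.sum_mul]
      have h1 := hrec i hi
      have h2 := hp i hi
      have h3 : ∑ j ∈ Finset.range i, ∏ k ∈ Finset.Icc 1 j, p k = p i / c := by
        rw [eq_div_iff hc.ne', mul_comm]; exact h1.symm
      rw [h3]
      field_simp
    rw [this, ← Finset.sum_div, Finset.sum_sub_distrib, hpsum, hρsum]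
    simp
  have hx : ∀ i ∈ Finset.Icc 1 K, 0 < ρ i / p i := fun i hi => div_pos (hρ i hi) (hp i hi)
  have key : ∑ j ∈ Finset.range (K + 1), ∏ i ∈ Finset.Icc 1 j, p i <
      (∑ j ∈ Finset.range (K + 1), ∏ i ∈ Finset.Icc 1 j, ρ i) *
        ((∏ i ∈ Finset.Icc 1 K, p i) / ∏ i ∈ Finset.Icc 1 K, ρ i) := by
    rw [Finset.sum_mul, Finset.sum_congr rfl hterm, ← hsum0]
    apply Finset.sum_lt_sum
    · intro j hj
      apply mul_le_mul_of_nonneg_left _ (hPpos p hp j hj).le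
      apply aux_tail
      intro i hi
      apply hx
      simp only [Finset.mem_Icc, Finset.mem_Ioc] at *
      omega
    · refine ⟨0, by simp, ?_⟩
      apply mul_lt_mul_of_pos_left _ (hPpos p hp 0 (by simp))
      apply aux_tail_strict
      · intro i hi
        apply hx
        simp only [Finset.mem_Icc, Finset.mem_Ioc] at *
        omega
      · obtain ⟨i, hi, hn⟩ := hne
        refine ⟨i, ?_, ?_⟩
        · simp only [Finset.mem_Icc, Finset.mem_Ioc] at *
          omega
        · intro h
          exact hn ((div_eq_one_iff_eq (hp i hi).ne').mp h)
  rw [div_lt_div_iff₀ (hDpos ρ hρ) (hDpos p hp)]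
  rw [← mul_div_assoc, lt_div_iff₀ hQK] at key
  linarith

/-- In the single-sensor chain POMDP of Example 4, the policy `π(c*)`
given by the recursion `π_1 = c*`, `π_i = π_{i−1} + c*·∏_{j<i} π_j`, with `c* > 0` the
normalizing constant, lies in the simplex `Δ_K` and is the unique maximizer over `Δ_K` of
`f(ρ) = (∏_{i=1}^K ρ_i)/(1 + Σ_{j=1}^K ∏_{i=1}^j ρ_i)`. -/
theorem stmt_11
    (K : ℕ) (hK : 1 ≤ K)
    (π : ℝ → ℕ → ℝ)
    (hπ1 : ∀ c : ℝ, π c 1 = c)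
    (hπrec : ∀ c : ℝ, ∀ i, 2 ≤ i → i ≤ K →
      π c i = π c (i - 1) + c * ∏ j ∈ Finset.Icc 1 (i - 1), π c j)
    (f : (ℕ → ℝ) → ℝ)
    (hf : ∀ ρ : ℕ → ℝ, f ρ = (∏ i ∈ Finset.Icc 1 K, ρ i) /
      (1 + ∑ j ∈ Finset.Icc 1 K, ∏ i ∈ Finset.Icc 1 j, ρ i))
    (c : ℝ) (hc : 0 < c) (hsum : ∑ i ∈ Finset.Icc 1 K, π c i = 1) :
    (∀ i ∈ Finset.Icc 1 K, 0 ≤ π c i) ∧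
    (∀ ρ : ℕ → ℝ, (∀ i ∈ Finset.Icc 1 K, 0 ≤ ρ i) →
      ∑ i ∈ Finset.Icc 1 K, ρ i = 1 → f ρ ≤ f (π c)) ∧
    (∀ ρ : ℕ → ℝ, (∀ i ∈ Finset.Icc 1 K, 0 ≤ ρ i) →
      ∑ i ∈ Finset.Icc 1 K, ρ i = 1 → f ρ = f (π c) →
      ∀ i ∈ Finset.Icc 1 K, ρ i = π c i) := by
  have hpos : ∀ n, n ≤ K → ∀ i ∈ Finset.Icc 1 n, 0 < π c i := by
    intro n
    induction n with
    | zero => intro _ i hi; simp at hi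
    | succ n ih =>
      intro hn i hi
      have ih' := ih (by omega)
      rw [Finset.mem_Icc] at hi
      by_cases h : i ≤ n
      · exact ih' i (Finset.mem_Icc.mpr ⟨hi.1, h⟩)
      · have hi' : i = n + 1 := by omega
        subst hi'
        rcases Nat.eq_zero_or_pos n with h0 | h0
        · subst h0
          rw [zero_add, hπ1]; exact hc
        · rw [hπrec c (n + 1) (by omega) hn, Nat.add_sub_cancel]
          have h1 := ih' n (Finset.mem_Icc.mpr ⟨h0, le_rfl⟩)
          have h2 := Finset.prod_pos ih'
          positivity
  have hp := hpos K le_rfl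
  have hrec : ∀ i, 1 ≤ i → i ≤ K →
      π c i = c * ∑ j ∈ Finset.range i, ∏ k ∈ Finset.Icc 1 j, π c k := by
    intro i hi
    induction i, hi using Nat.le_induction with
    | base => intro _; simp [hπ1]
    | succ n hn ih =>
      intro hnK
      rw [hπrec c (n + 1) (by omega) hnK, Nat.add_sub_cancel, Finset.sum_range_succ,
        ih (by omega)]
      ring
  have main : ∀ ρ : ℕ → ℝ, (∀ i ∈ Finset.Icc 1 K, 0 ≤ ρ i) →
      ∑ i ∈ Finset.Icc 1 K, ρ i = 1 → (∃ i ∈ Finset.Icc 1 K, ρ i ≠ π c i) → f ρ < f (π c) := by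
    intro ρ h0 h1 hne
    by_cases hz : ∃ i ∈ Finset.Icc 1 K, ρ i = 0
    · obtain ⟨i, hi, hi0⟩ := hz
      rw [hf ρ, hf (π c), Finset.prod_eq_zero hi hi0, zero_div]
      apply div_pos (Finset.prod_pos hp)
      apply add_pos_of_pos_of_nonneg one_pos
      apply Finset.sum_nonneg
      intro j hj
      exact (Finset.prod_pos (hpos j (Finset.mem_Icc.mp hj).2)).le
    · push Not at hz
      rw [hf ρ, hf (π c), aux_den, aux_den]
      exact aux_main K (π c) ρ c hc hp
        (fun i hi => hrec i (Finset.mem_Icc.mp hi).1 (Finset.mem_Icc.mp hi).2) hsum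
        (fun i hi => lt_of_le_of_ne (h0 i hi) (hz i hi).symm) h1 hne
  refine ⟨fun i hi => (hp i hi).le, ?_, ?_⟩
  · intro ρ h0 h1
    by_cases hne : ∃ i ∈ Finset.Icc 1 K, ρ i ≠ π c i
    · exact (main ρ h0 h1 hne).le
    · push Not at hne
      apply le_of_eq
      rw [hf ρ, hf (π c), Finset.prod_congr rfl hne]
      congr 2
      apply Finset.sum_congr rfl
      intro j hj
      apply Finset.prod_congr rfl
      intro i hi
      apply hne
      simp only [Finset.mem_Icc] at *
      omega
  · intro ρ h0 h1 heq
    by_contra hcon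
    push Not at hcon
    exact absurd heq (main ρ h0 h1 hcon).ne
end

section
/- Let K ≥ 1 and t_1, …, t_K ∈ (0,1]. Define f_t on the simplex Δ_K := { π ∈ ℝ^K : π_i ≥ 0, Σ_i π_i = 1 } by f_t(π) = (∏_{i=1}^K t_i·π_i) / (1 + Σ_{j=1}^K ∏_{i=1}^j t_i·π_i). For c > 0 define π(c) recursively by π_1(c) = c and π_i(c) = π_{i−1}(c) + c·∏_{j=1}^{i−1} t_j·π_j(c) for i = 2, …, K, and let c* be the unique c > 0 with Σ_i π_i(c) = 1. Then π(c*) ∈ Δ_K and π(c*) is the unique maximizer of f_t over Δ_K. -/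
lemma aux_le (s : Finset ℕ) (x : ℕ → ℝ) (hx : ∀ i ∈ s, 0 < x i) :
    1 + ∑ i ∈ s, (1 - x i) ≤ (∏ i ∈ s, x i)⁻¹ := by
  have h1 : (∏ i ∈ s, x i) = Real.exp (∑ i ∈ s, Real.log (x i)) := by
    rw [Real.exp_sum]
    exact Finset.prod_congr rfl fun i hi => (Real.exp_log (hx i hi)).symm
  have h2 : ∑ i ∈ s, Real.log (x i) ≤ ∑ i ∈ s, (x i - 1) :=
    Finset.sum_le_sum fun i hi => Real.log_le_sub_one_of_pos (hx i hi)
  have h3 : ∑ i ∈ s, (x i - 1) = - ∑ i ∈ s, (1 - x i) := by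
    rw [← Finset.sum_neg_distrib]; exact Finset.sum_congr rfl fun i _ => by ring
  rw [h1, ← Real.exp_neg]
  linarith [Real.add_one_le_exp (-∑ i ∈ s, Real.log (x i))]

lemma aux_lt (s : Finset ℕ) (x : ℕ → ℝ) (hx : ∀ i ∈ s, 0 < x i) (hne : ∃ i ∈ s, x i ≠ 1) :
    1 + ∑ i ∈ s, (1 - x i) < (∏ i ∈ s, x i)⁻¹ := by
  have h1 : (∏ i ∈ s, x i) = Real.exp (∑ i ∈ s, Real.log (x i)) := by
    rw [Real.exp_sum]
    exact Finset.prod_congr rfl fun i hi => (Real.exp_log (hx i hi)).symm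
  have h2 : ∑ i ∈ s, Real.log (x i) < ∑ i ∈ s, (x i - 1) := by
    obtain ⟨i, hi, hi1⟩ := hne
    exact Finset.sum_lt_sum (fun i hi => Real.log_le_sub_one_of_pos (hx i hi))
      ⟨i, hi, Real.log_lt_sub_one_of_pos (hx i hi) hi1⟩
  have h3 : ∑ i ∈ s, (x i - 1) = - ∑ i ∈ s, (1 - x i) := by
    rw [← Finset.sum_neg_distrib]; exact Finset.sum_congr rfl fun i _ => by ring
  rw [h1, ← Real.exp_neg]
  linarith [Real.add_one_le_exp (-∑ i ∈ s, Real.log (x i))]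

lemma aux_sum (K : ℕ) (P : ℕ → ℝ) (h0 : P 0 = 1) :
    1 + ∑ j ∈ Finset.Icc 1 K, P j = ∑ j ∈ Finset.range (K + 1), P j := by
  induction K with
  | zero => simp [h0]
  | succ n ih =>
    rw [Finset.sum_range_succ, ← ih, Finset.sum_Icc_succ_top (by omega)]; ring

lemma aux_core (K : ℕ) (hK : 1 ≤ K) (P x p ρ : ℕ → ℝ) (c : ℝ) (hc : 0 < c)
    (hP : ∀ j ≤ K, 0 < P j)
    (hp : ∀ i ∈ Finset.Icc 1 K, p i = c * ∑ j ∈ Finset.range i, P j)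
    (hp0 : ∀ i ∈ Finset.Icc 1 K, 0 < p i)
    (hx : ∀ i ∈ Finset.Icc 1 K, 0 < x i)
    (hρ : ∀ i ∈ Finset.Icc 1 K, ρ i = p i * x i)
    (hs : ∑ i ∈ Finset.Icc 1 K, p i = ∑ i ∈ Finset.Icc 1 K, ρ i)
    (hne : ∃ i ∈ Finset.Icc 1 K, x i ≠ 1) :
    (∏ i ∈ Finset.Icc 1 K, x i) * ∑ j ∈ Finset.range (K + 1), P j <
      ∑ j ∈ Finset.range (K + 1), P j * ∏ i ∈ Finset.Icc 1 j, x i := by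
  have hz : ∑ j ∈ Finset.range (K + 1), P j * ∑ i ∈ Finset.Ioc j K, (1 - x i) = 0 := by
    have e1 : ∑ j ∈ Finset.range (K + 1), P j * ∑ i ∈ Finset.Ioc j K, (1 - x i)
        = ∑ i ∈ Finset.Icc 1 K, ∑ j ∈ Finset.range i, P j * (1 - x i) := by
      simp_rw [Finset.mul_sum]
      apply Finset.sum_comm'
      intro a b
      simp only [Finset.mem_range, Finset.mem_Ioc, Finset.mem_Icc]
      omega
    have e2 : c * ∑ i ∈ Finset.Icc 1 K, ∑ j ∈ Finset.range i, P j * (1 - x i)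
        = ∑ i ∈ Finset.Icc 1 K, (p i - ρ i) := by
      rw [Finset.mul_sum]
      refine Finset.sum_congr rfl fun i hi => ?_
      rw [← Finset.sum_mul, hρ i hi, ← mul_assoc, ← hp i hi]; ring
    rw [Finset.sum_sub_distrib, hs, sub_self] at e2
    rw [e1]
    exact (mul_eq_zero.mp e2).resolve_left hc.ne'
  have hXK : 0 < ∏ i ∈ Finset.Icc 1 K, x i := Finset.prod_pos hx
  have hsplit : ∀ j ≤ K, (∏ i ∈ Finset.Icc 1 j, x i)
      = (∏ i ∈ Finset.Icc 1 K, x i) * (∏ i ∈ Finset.Ioc j K, x i)⁻¹ := by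
    intro j hj
    have hpos : 0 < ∏ i ∈ Finset.Ioc j K, x i := Finset.prod_pos fun i hi => hx i (by
      simp only [Finset.mem_Ioc, Finset.mem_Icc] at *; omega)
    rw [eq_mul_inv_iff_mul_eq₀ hpos.ne']
    have := Finset.prod_Ioc_consecutive x (Nat.zero_le j) hj
    simpa [← Finset.Icc_succ_left_eq_Ioc] using this
  have e : ∑ j ∈ Finset.range (K + 1), P j * ∏ i ∈ Finset.Icc 1 j, x i
      = (∏ i ∈ Finset.Icc 1 K, x i) *
        ∑ j ∈ Finset.range (K + 1), P j * (∏ i ∈ Finset.Ioc j K, x i)⁻¹ := by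
    rw [Finset.mul_sum]
    refine Finset.sum_congr rfl fun j hj => ?_
    rw [hsplit j (by simp at hj; omega)]; ring
  rw [e]
  refine mul_lt_mul_of_pos_left ?_ hXK
  calc ∑ j ∈ Finset.range (K + 1), P j
      = ∑ j ∈ Finset.range (K + 1), P j * (1 + ∑ i ∈ Finset.Ioc j K, (1 - x i)) := by
        simp_rw [mul_add, mul_one]; rw [Finset.sum_add_distrib, hz, add_zero]
    _ < _ := by
        apply Finset.sum_lt_sum
        · intro j hj
          refine mul_le_mul_of_nonneg_left (aux_le _ _ ?_) (hP j (by simp at hj; omega)).le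
          intro i hi
          exact hx i (by simp only [Finset.mem_Ioc, Finset.mem_Icc] at *; omega)
        · refine ⟨0, by simp, mul_lt_mul_of_pos_left (aux_lt _ _ ?_ ?_) (hP 0 (by omega))⟩
          · intro i hi
            exact hx i (by simp only [Finset.mem_Ioc, Finset.mem_Icc] at *; omega)
          · obtain ⟨i, hi, h⟩ := hne
            exact ⟨i, by simp only [Finset.mem_Ioc, Finset.mem_Icc] at *; omega, h⟩

/-- In the chain POMDP of Example 5 with success probabilities `t_i`,
the policy `π(c*)` given by `π_1 = c*`, `π_i = π_{i−1} + c*·∏_{j<i} t_j·π_j`, with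
`c* > 0` the normalizing constant, lies in `Δ_K` and is the unique maximizer over `Δ_K`
of `f_t(ρ) = (∏_i t_i·ρ_i)/(1 + Σ_j ∏_{i≤j} t_i·ρ_i)`. -/
theorem stmt_12
    (K : ℕ) (hK : 1 ≤ K) (t : ℕ → ℝ)
    (ht : ∀ i ∈ Finset.Icc 1 K, t i ∈ Set.Ioc (0 : ℝ) 1)
    (π : ℝ → ℕ → ℝ)
    (hπ1 : ∀ c : ℝ, π c 1 = c)
    (hπrec : ∀ c : ℝ, ∀ i, 2 ≤ i → i ≤ K →
      π c i = π c (i - 1) + c * ∏ j ∈ Finset.Icc 1 (i - 1), t j * π c j)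
    (f : (ℕ → ℝ) → ℝ)
    (hf : ∀ ρ : ℕ → ℝ, f ρ = (∏ i ∈ Finset.Icc 1 K, t i * ρ i) /
      (1 + ∑ j ∈ Finset.Icc 1 K, ∏ i ∈ Finset.Icc 1 j, t i * ρ i))
    (c : ℝ) (hc : 0 < c) (hsum : ∑ i ∈ Finset.Icc 1 K, π c i = 1) :
    (∀ i ∈ Finset.Icc 1 K, 0 ≤ π c i) ∧
    (∀ ρ : ℕ → ℝ, (∀ i ∈ Finset.Icc 1 K, 0 ≤ ρ i) →
      ∑ i ∈ Finset.Icc 1 K, ρ i = 1 → f ρ ≤ f (π c)) ∧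
    (∀ ρ : ℕ → ℝ, (∀ i ∈ Finset.Icc 1 K, 0 ≤ ρ i) →
      ∑ i ∈ Finset.Icc 1 K, ρ i = 1 → f ρ = f (π c) →
      ∀ i ∈ Finset.Icc 1 K, ρ i = π c i) := by
  have hA : ∀ i, 1 ≤ i → i ≤ K → (π c i = c * ∑ j ∈ Finset.range i,
      ∏ k ∈ Finset.Icc 1 j, t k * π c k) := by
    intro i h1
    induction i, h1 using Nat.le_induction with
    | base => intro _; simp [hπ1]
    | succ n hn ih =>
      intro h
      have := hπrec c (n + 1) (by omega) h
      rw [Nat.add_sub_cancel, ih (by omega)] at this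
      rw [this, Finset.sum_range_succ, mul_add]
  have hpos : ∀ i, 1 ≤ i → i ≤ K → 0 < π c i := by
    intro i
    induction i using Nat.strong_induction_on with
    | _ i ih =>
      intro h1 h2
      rw [hA i h1 h2]
      refine mul_pos hc (Finset.sum_pos ?_ ⟨0, by simp; omega⟩)
      intro j hj
      refine Finset.prod_pos fun k hk => ?_
      simp only [Finset.mem_range, Finset.mem_Icc] at hj hk
      exact mul_pos (ht k (by simp; omega)).1 (ih k (by omega) (by omega) (by omega))
  have hP : ∀ j ≤ K, 0 < ∏ k ∈ Finset.Icc 1 j, t k * π c k := by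
    intro j hj
    refine Finset.prod_pos fun k hk => ?_
    simp only [Finset.mem_Icc] at hk
    exact mul_pos (ht k (by simp; omega)).1 (hpos k (by omega) (by omega))
  have hf' : ∀ ρ : ℕ → ℝ, f ρ = (∏ i ∈ Finset.Icc 1 K, t i * ρ i) /
      ∑ j ∈ Finset.range (K + 1), ∏ i ∈ Finset.Icc 1 j, t i * ρ i := by
    intro ρ
    rw [hf, aux_sum K (fun j => ∏ i ∈ Finset.Icc 1 j, t i * ρ i) (by simp)]
  have hSπ : 0 < ∑ j ∈ Finset.range (K + 1), ∏ i ∈ Finset.Icc 1 j, t i * π c i :=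
    Finset.sum_pos (fun j hj => hP j (by simp at hj; omega)) ⟨0, by simp⟩
  have key : ∀ ρ : ℕ → ℝ, (∀ i ∈ Finset.Icc 1 K, 0 ≤ ρ i) →
      ∑ i ∈ Finset.Icc 1 K, ρ i = 1 → (∃ i ∈ Finset.Icc 1 K, ρ i ≠ π c i) →
      f ρ < f (π c) := by
    intro ρ h0 h1 hne
    by_cases hz : ∃ i ∈ Finset.Icc 1 K, ρ i = 0
    · obtain ⟨i, hi, hi0⟩ := hz
      rw [hf' ρ, Finset.prod_eq_zero hi (by simp [hi0]), zero_div, hf']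
      exact div_pos (hP K le_rfl) hSπ
    · push Not at hz
      have hρ : ∀ i ∈ Finset.Icc 1 K, 0 < ρ i := fun i hi =>
        lt_of_le_of_ne (h0 i hi) (hz i hi).symm
      have hp : ∀ i ∈ Finset.Icc 1 K, 0 < π c i := fun i hi => by
        simp only [Finset.mem_Icc] at hi; exact hpos i hi.1 hi.2
      have hmul : ∀ i ∈ Finset.Icc 1 K, ρ i = π c i * (ρ i / π c i) := fun i hi => by
        rw [mul_div_cancel₀ _ (hp i hi).ne']
      have hprod : ∀ j ≤ K, ∏ i ∈ Finset.Icc 1 j, t i * ρ i =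
          (∏ i ∈ Finset.Icc 1 j, t i * π c i) * ∏ i ∈ Finset.Icc 1 j, (ρ i / π c i) := by
        intro j hj
        rw [← Finset.prod_mul_distrib]
        refine Finset.prod_congr rfl fun i hi => ?_
        rw [mul_assoc, ← hmul i (Finset.Icc_subset_Icc_right hj hi)]
      have hcore := aux_core K hK (fun j => ∏ i ∈ Finset.Icc 1 j, t i * π c i)
        (fun i => ρ i / π c i) (π c) ρ c hc hP
        (fun i hi => by simp only [Finset.mem_Icc] at hi; exact hA i hi.1 hi.2) hp
        (fun i hi => div_pos (hρ i hi) (hp i hi)) hmul (by rw [hsum, h1])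
        (by
          obtain ⟨i, hi, h⟩ := hne
          exact ⟨i, hi, fun h' => h ((div_eq_one_iff_eq (hp i hi).ne').mp h')⟩)
      have hSρ : ∑ j ∈ Finset.range (K + 1), ∏ i ∈ Finset.Icc 1 j, t i * ρ i =
          ∑ j ∈ Finset.range (K + 1), (∏ i ∈ Finset.Icc 1 j, t i * π c i) *
            ∏ i ∈ Finset.Icc 1 j, (ρ i / π c i) :=
        Finset.sum_congr rfl fun j hj => hprod j (by simp at hj; omega)
      have hSpos : 0 < ∑ j ∈ Finset.range (K + 1), ∏ i ∈ Finset.Icc 1 j, t i * ρ i := by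
        refine Finset.sum_pos (fun j hj => Finset.prod_pos fun i hi => ?_) ⟨0, by simp⟩
        have hi' : i ∈ Finset.Icc 1 K := by
          simp only [Finset.mem_range, Finset.mem_Icc] at *; omega
        exact mul_pos (ht i hi').1 (hρ i hi')
      rw [hf', hf', div_lt_div_iff₀ hSpos hSπ, hprod K le_rfl, hSρ, mul_assoc]
      exact mul_lt_mul_of_pos_left hcore (hP K le_rfl)
  refine ⟨?_, ?_, ?_⟩
  · intro i hi
    simp only [Finset.mem_Icc] at hi
    exact (hpos i hi.1 hi.2).le
  · intro ρ h0 h1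
    by_cases hne : ∃ i ∈ Finset.Icc 1 K, ρ i ≠ π c i
    · exact (key ρ h0 h1 hne).le
    · push Not at hne
      have e : ∀ j ≤ K, ∏ i ∈ Finset.Icc 1 j, t i * ρ i = ∏ i ∈ Finset.Icc 1 j, t i * π c i :=
        fun j hj => Finset.prod_congr rfl fun i hi => by
          rw [hne i (Finset.Icc_subset_Icc_right hj hi)]
      rw [hf', hf', e K le_rfl,
        Finset.sum_congr rfl fun j hj => e j (by simp at hj; omega)]
  · intro ρ h0 h1 heq
    by_contra! hne
    exact (key ρ h0 h1 hne).ne heq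
end

section
/- Let K ≥ 2. For t = (t_1,…,t_K) ∈ (0,1]^K define f_t on Δ_K := { π ∈ ℝ^K : π_i ≥ 0, Σ_i π_i = 1 } by f_t(π) = (∏_{i=1}^K t_i·π_i) / (1 + Σ_{j=1}^K ∏_{i=1}^j t_i·π_i), and let π*(t) ∈ Δ_K denote its (unique) maximizer over Δ_K. Then there is a choice of t ∈ (0,1]^K for which π*(t) cannot be written as a convex combination of K−1 or fewer vertices of Δ_K (i.e. of K−1 deterministic policies); equivalently, π*(t) has all K coordinates strictly positive. -/
/-- For `K ≥ 2` there is a choice of `t ∈ (0,1]^K` for which every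
maximizer of `f_t` over the simplex `Δ_K` has all `K` coordinates strictly positive,
i.e. it is not a convex combination of `K−1` or fewer deterministic policies. -/
theorem stmt_13
    (K : ℕ) (hK : 2 ≤ K) :
    ∃ t : ℕ → ℝ, (∀ i ∈ Finset.Icc 1 K, t i ∈ Set.Ioc (0 : ℝ) 1) ∧
      ∀ π : ℕ → ℝ, (∀ i ∈ Finset.Icc 1 K, 0 ≤ π i) →
        (∑ i ∈ Finset.Icc 1 K, π i = 1) →
        (∀ ρ : ℕ → ℝ, (∀ i ∈ Finset.Icc 1 K, 0 ≤ ρ i) →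
          (∑ i ∈ Finset.Icc 1 K, ρ i = 1) →
          (∏ i ∈ Finset.Icc 1 K, t i * ρ i) /
              (1 + ∑ j ∈ Finset.Icc 1 K, ∏ i ∈ Finset.Icc 1 j, t i * ρ i)
            ≤ (∏ i ∈ Finset.Icc 1 K, t i * π i) /
              (1 + ∑ j ∈ Finset.Icc 1 K, ∏ i ∈ Finset.Icc 1 j, t i * π i)) →
        ∀ i ∈ Finset.Icc 1 K, 0 < π i := by
  refine ⟨fun _ => 1, fun i _ => by norm_num, ?_⟩
  intro π hπ _ hmax i hi
  have hKpos : (0 : ℝ) < K := by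
    have : 0 < K := by omega
    exact_mod_cast this
  have h := hmax (fun _ => (K : ℝ)⁻¹) (fun _ _ => by positivity) (by
    simp [hKpos.ne'])
  rcases (hπ i hi).lt_or_eq with h0 | h0
  · exact h0
  · exfalso
    have hz : (∏ i ∈ Finset.Icc 1 K, (1 : ℝ) * π i) = 0 :=
      Finset.prod_eq_zero hi (by rw [← h0, mul_zero])
    rw [hz, zero_div] at h
    have hp : 0 < (∏ i ∈ Finset.Icc 1 K, (1 : ℝ) * (K : ℝ)⁻¹) /
        (1 + ∑ j ∈ Finset.Icc 1 K, ∏ i ∈ Finset.Icc 1 j, (1 : ℝ) * (K : ℝ)⁻¹) := by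
      apply div_pos
      · exact Finset.prod_pos fun _ _ => by positivity
      · exact add_pos_of_pos_of_nonneg one_pos
          (Finset.sum_nonneg fun _ _ => Finset.prod_nonneg fun _ _ => by positivity)
    exact absurd h (not_le.mpr hp)
end

section
/- Let U ≥ 1, K ≥ 1, and t_{ji} ∈ (0,1] for j = 1,…,U and i = 1,…,K. Order the index pairs (j,i) lexicographically. For π ∈ (Δ_K)^U (one probability vector π_{j·} ∈ Δ_K for each j) define F(π) = (∏_{j,i} t_{ji}·π_{ji}) / (1 + Σ_{(j,i)} ∏_{(j',i') ≤ (j,i)} t_{j'i'}·π_{j'i'}), where the outer sum runs over all pairs (j,i) and the inner product over all pairs (j',i') less than or equal to (j,i) lexicographically. For each j let d_j := 1 + Σ_{(j',i') ≤ (j−1,K)} ∏_{(j'',i'') ≤ (j',i')} t_{j''i''}·π_{j''i''} and e_j := ∏_{(j',i') ≤ (j−1,K)} t_{j'i'}·π_{j'i'} (with empty sums equal to 0 and empty products equal to 1). Then the policy defined recursively by π_{j1} = c_j·d_j and π_{ji} = π_{j,i−1} + c_j·e_j·∏_{i'=1}^{i−1} t_{ji'}·π_{ji'} for i = 2,…,K,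 where c_j is the unique positive real solution of π_{j1} + ⋯ + π_{jK} = 1, maximizes F over (Δ_K)^U. -/
theorem aux_prod_ineq {ι : Type*} (Q : Finset ι) (t a b : ι → ℝ)
    (ht : ∀ q ∈ Q, 0 < t q) (ha : ∀ q ∈ Q, 0 < a q) (hb : ∀ q ∈ Q, 0 < b q) :
    (∏ q ∈ Q, t q * b q) * (1 + ∑ q ∈ Q, (1 - b q / a q)) ≤ ∏ q ∈ Q, t q * a q := by
  have hB : 0 < ∏ q ∈ Q, t q * b q := Finset.prod_pos fun q hq => mul_pos (ht q hq) (hb q hq)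
  have hr : ∏ q ∈ Q, t q * a q = (∏ q ∈ Q, t q * b q) * ∏ q ∈ Q, (a q / b q) := by
    rw [← Finset.prod_mul_distrib]
    refine Finset.prod_congr rfl fun q hq => ?_
    have := (hb q hq).ne'
    field_simp
  rw [hr]
  refine mul_le_mul_of_nonneg_left ?_ hB.le
  have hR : 0 < ∏ q ∈ Q, (a q / b q) := Finset.prod_pos fun q hq => div_pos (ha q hq) (hb q hq)
  have h1 := Real.log_le_sub_one_of_pos hR
  rw [Real.log_prod (fun q hq => (div_pos (ha q hq) (hb q hq)).ne')] at h1
  have h2 : ∑ q ∈ Q, (1 - b q / a q) ≤ ∑ q ∈ Q, Real.log (a q / b q) := by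
    refine Finset.sum_le_sum fun q hq => ?_
    have := Real.one_sub_inv_le_log_of_pos (div_pos (ha q hq) (hb q hq))
    rwa [inv_div] at this
  linarith

theorem aux_core_s15 {ι : Type*} (S : Finset ι) (R : ι → ι → Prop) [DecidableRel R] (t a b : ι → ℝ)
    (ht : ∀ q ∈ S, 0 < t q) (ha : ∀ q ∈ S, 0 < a q) (hb : ∀ q ∈ S, 0 < b q)
    (h : ∑ q ∈ S, (1 - b q / a q) * (1 + ∑ p ∈ S.filter (fun p => ¬ R q p),
      ∏ r ∈ S.filter (fun r => R r p), t r * a r) = 0) :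
    (∏ q ∈ S, t q * b q) / (1 + ∑ p ∈ S, ∏ r ∈ S.filter (fun r => R r p), t r * b r) ≤
    (∏ q ∈ S, t q * a q) / (1 + ∑ p ∈ S, ∏ r ∈ S.filter (fun r => R r p), t r * a r) := by
  have hTa : ∀ p, 0 < ∏ r ∈ S.filter (fun r => R r p), t r * a r := fun p =>
    Finset.prod_pos fun q hq => mul_pos (ht q (Finset.mem_filter.1 hq).1)
      (ha q (Finset.mem_filter.1 hq).1)
  have hTb : ∀ p, 0 < ∏ r ∈ S.filter (fun r => R r p), t r * b r := fun p =>
    Finset.prod_pos fun q hq => mul_pos (ht q (Finset.mem_filter.1 hq).1)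
      (hb q (Finset.mem_filter.1 hq).1)
  have hDa : 0 < 1 + ∑ p ∈ S, ∏ r ∈ S.filter (fun r => R r p), t r * a r :=
    add_pos_of_pos_of_nonneg one_pos (Finset.sum_nonneg fun p _ => (hTa p).le)
  have hDb : 0 < 1 + ∑ p ∈ S, ∏ r ∈ S.filter (fun r => R r p), t r * b r :=
    add_pos_of_pos_of_nonneg one_pos (Finset.sum_nonneg fun p _ => (hTb p).le)
  rw [div_le_div_iff₀ hDb hDa]
  have h0 := aux_prod_ineq S t a b ht ha hb
  have hp : ∀ p ∈ S, (∏ q ∈ S, t q * b q) * ((∏ r ∈ S.filter (fun r => R r p), t r * a r) *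
      (1 + ∑ q ∈ S.filter (fun q => ¬ R q p), (1 - b q / a q))) ≤
      (∏ q ∈ S, t q * a q) * ∏ r ∈ S.filter (fun r => R r p), t r * b r := by
    intro p _
    have h1 := aux_prod_ineq (S.filter (fun q => ¬ R q p)) t a b
      (fun q hq => ht q (Finset.mem_filter.1 hq).1) (fun q hq => ha q (Finset.mem_filter.1 hq).1)
      (fun q hq => hb q (Finset.mem_filter.1 hq).1)
    rw [← Finset.prod_filter_mul_prod_filter_not S (fun r => R r p) (fun q => t q * b q),
      ← Finset.prod_filter_mul_prod_filter_not S (fun r => R r p) (fun q => t q * a q)]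
    have h2 := mul_le_mul_of_nonneg_left h1 (mul_pos (hTa p) (hTb p)).le
    linarith
  have hs := Finset.sum_le_sum hp
  rw [← Finset.mul_sum, ← Finset.mul_sum] at hs
  have hswap : ∑ p ∈ S, ((∏ r ∈ S.filter (fun r => R r p), t r * a r) *
      (1 + ∑ q ∈ S.filter (fun q => ¬ R q p), (1 - b q / a q))) =
      (∑ p ∈ S, ∏ r ∈ S.filter (fun r => R r p), t r * a r) - ∑ q ∈ S, (1 - b q / a q) := by
    have e1 : ∑ q ∈ S, (1 - b q / a q) * (∑ p ∈ S.filter (fun p => ¬ R q p),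
        ∏ r ∈ S.filter (fun r => R r p), t r * a r) =
        ∑ p ∈ S, (∏ r ∈ S.filter (fun r => R r p), t r * a r) *
          ∑ q ∈ S.filter (fun q => ¬ R q p), (1 - b q / a q) := by
      simp_rw [Finset.mul_sum, Finset.sum_filter]
      rw [Finset.sum_comm]
      refine Finset.sum_congr rfl fun p _ => Finset.sum_congr rfl fun q _ => ?_
      split_ifs
      · rfl
      · exact mul_comm _ _
    simp_rw [mul_add, mul_one, Finset.sum_add_distrib] at h ⊢
    rw [e1] at h
    linarith
  rw [hswap] at hs
  nlinarith

/-- In the multi-sensor chain POMDP of Example 6 (with `U` sensor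
states, `K` actions, success probabilities `t_{ji}`, and indices ordered
lexicographically), the policy defined blockwise by `π_{j1} = c_j·d_j`,
`π_{ji} = π_{j,i−1} + c_j·e_j·∏_{i'<i} t_{ji'}·π_{ji'}`, with `c_j > 0` the normalizing
constant of block `j`, maximizes the stationary reward probability `F` over `(Δ_K)^U`. -/
theorem stmt_15
    (U K : ℕ) (hU : 1 ≤ U) (hK : 1 ≤ K)
    (t : ℕ → ℕ → ℝ)
    (ht : ∀ j ∈ Finset.Icc 1 U, ∀ i ∈ Finset.Icc 1 K, t j i ∈ Set.Ioc (0 : ℝ) 1)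
    (F : (ℕ → ℕ → ℝ) → ℝ)
    (hF : ∀ ρ : ℕ → ℕ → ℝ, F ρ =
      (∏ p ∈ Finset.Icc 1 U ×ˢ Finset.Icc 1 K, t p.1 p.2 * ρ p.1 p.2) /
      (1 + ∑ p ∈ Finset.Icc 1 U ×ˢ Finset.Icc 1 K,
        ∏ q ∈ (Finset.Icc 1 U ×ˢ Finset.Icc 1 K).filter
          (fun q : ℕ × ℕ => q.1 < p.1 ∨ (q.1 = p.1 ∧ q.2 ≤ p.2)),
          t q.1 q.2 * ρ q.1 q.2))
    (π : ℕ → ℕ → ℝ) (c d e : ℕ → ℝ)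
    (hd : ∀ j, d j = 1 + ∑ p ∈ Finset.Icc 1 (j - 1) ×ˢ Finset.Icc 1 K,
        ∏ q ∈ (Finset.Icc 1 (j - 1) ×ˢ Finset.Icc 1 K).filter
          (fun q : ℕ × ℕ => q.1 < p.1 ∨ (q.1 = p.1 ∧ q.2 ≤ p.2)),
          t q.1 q.2 * π q.1 q.2)
    (he : ∀ j, e j = ∏ p ∈ Finset.Icc 1 (j - 1) ×ˢ Finset.Icc 1 K, t p.1 p.2 * π p.1 p.2)
    (hc : ∀ j ∈ Finset.Icc 1 U, 0 < c j)
    (hπ1 : ∀ j ∈ Finset.Icc 1 U, π j 1 = c j * d j)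
    (hπrec : ∀ j ∈ Finset.Icc 1 U, ∀ i, 2 ≤ i → i ≤ K →
      π j i = π j (i - 1) + c j * e j * ∏ i' ∈ Finset.Icc 1 (i - 1), t j i' * π j i')
    (hsum : ∀ j ∈ Finset.Icc 1 U, ∑ i ∈ Finset.Icc 1 K, π j i = 1) :
    (∀ j ∈ Finset.Icc 1 U, ∀ i ∈ Finset.Icc 1 K, 0 ≤ π j i) ∧
    ∀ ρ : ℕ → ℕ → ℝ,
      (∀ j ∈ Finset.Icc 1 U, ∀ i ∈ Finset.Icc 1 K, 0 ≤ ρ j i) →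
      (∀ j ∈ Finset.Icc 1 U, ∑ i ∈ Finset.Icc 1 K, ρ j i = 1) →
      F ρ ≤ F π := by

  have htp : ∀ j ∈ Finset.Icc 1 U, ∀ i ∈ Finset.Icc 1 K, 0 < t j i := fun j hj i hi => (ht j hj i hi).1
  have hpos : ∀ j, j ∈ Finset.Icc 1 U → ∀ i ∈ Finset.Icc 1 K, 0 < π j i := by
    intro j
    induction j using Nat.strong_induction_on with
    | _ j ih =>
      intro hj
      have hx : ∀ p ∈ Finset.Icc 1 (j - 1) ×ˢ Finset.Icc 1 K, 0 < t p.1 p.2 * π p.1 p.2 := by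
        intro p hp
        simp only [Finset.mem_product, Finset.mem_Icc] at hp hj
        have h1 : p.1 ∈ Finset.Icc 1 U := by rw [Finset.mem_Icc]; omega
        have h2 : p.2 ∈ Finset.Icc 1 K := by rw [Finset.mem_Icc]; omega
        exact mul_pos (htp _ h1 _ h2) (ih p.1 (by omega) h1 _ h2)
      have hdp : 0 < d j := by
        rw [hd]
        exact add_pos_of_pos_of_nonneg one_pos (Finset.sum_nonneg fun p _ =>
          Finset.prod_nonneg fun q hq => (hx q (Finset.mem_filter.1 hq).1).le)
      have hep : 0 < e j := by
        rw [he]; exact Finset.prod_pos hx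
      intro i
      induction i using Nat.strong_induction_on with
      | _ i ihi =>
        intro hi
        rw [Finset.mem_Icc] at hi
        rcases Nat.lt_or_ge i 2 with h | h
        · obtain rfl : i = 1 := by omega
          rw [hπ1 j hj]
          exact mul_pos (hc j hj) hdp
        · rw [hπrec j hj i h hi.2]
          refine add_pos (ihi (i-1) (by omega) (by rw [Finset.mem_Icc]; omega))
            (mul_pos (mul_pos (hc j hj) hep) (Finset.prod_pos fun k hk => ?_))
          rw [Finset.mem_Icc] at hk
          have hk' : k ∈ Finset.Icc 1 K := by rw [Finset.mem_Icc]; omega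
          exact mul_pos (htp j hj k hk') (ihi k (by omega) hk')
  refine ⟨fun j hj i hi => (hpos j hj i hi).le, fun ρ hρ0 hρ1 => ?_⟩
  have hS : ∀ p ∈ Finset.Icc 1 U ×ˢ Finset.Icc 1 K, p.1 ∈ Finset.Icc 1 U ∧ p.2 ∈ Finset.Icc 1 K :=
    fun p hp => Finset.mem_product.1 hp
  have key : ∀ j ∈ Finset.Icc 1 U, ∀ i, 1 ≤ i → i ≤ K →
      c j * (1 + ∑ p ∈ (Finset.Icc 1 U ×ˢ Finset.Icc 1 K).filter
          (fun p : ℕ × ℕ => ¬ (j < p.1 ∨ (j = p.1 ∧ i ≤ p.2))),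
        ∏ q ∈ (Finset.Icc 1 U ×ˢ Finset.Icc 1 K).filter
          (fun q : ℕ × ℕ => q.1 < p.1 ∨ (q.1 = p.1 ∧ q.2 ≤ p.2)),
          t q.1 q.2 * π q.1 q.2) = π j i := by
    intro j hj i hi
    have hj' := Finset.mem_Icc.1 hj
    induction i, hi using Nat.le_induction with
    | base =>
      intro _
      rw [hπ1 j hj, hd]
      congr 2
      refine Finset.sum_congr ?_ fun p hp => Finset.prod_congr ?_ fun _ _ => rfl
      · ext ⟨a, b⟩
        simp only [Finset.mem_filter, Finset.mem_product, Finset.mem_Icc]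
        omega
      · ext ⟨a, b⟩
        simp only [Finset.mem_filter, Finset.mem_product, Finset.mem_Icc] at hp ⊢
        omega
    | succ i hi ih =>
      intro hiK
      rw [hπrec j hj (i+1) (by omega) hiK, Nat.add_sub_cancel, ← ih (by omega)]
      have hins : (Finset.Icc 1 U ×ˢ Finset.Icc 1 K).filter
          (fun p : ℕ × ℕ => ¬ (j < p.1 ∨ (j = p.1 ∧ i + 1 ≤ p.2))) =
          insert (j, i) ((Finset.Icc 1 U ×ˢ Finset.Icc 1 K).filter
          (fun p : ℕ × ℕ => ¬ (j < p.1 ∨ (j = p.1 ∧ i ≤ p.2)))) := by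
        ext ⟨a, b⟩
        simp only [Finset.mem_insert, Finset.mem_filter, Finset.mem_product, Finset.mem_Icc,
          Prod.mk.injEq]
        omega
      rw [hins, Finset.sum_insert (by simp)]
      have hT : ∏ q ∈ (Finset.Icc 1 U ×ˢ Finset.Icc 1 K).filter
          (fun q : ℕ × ℕ => q.1 < j ∨ (q.1 = j ∧ q.2 ≤ i)), t q.1 q.2 * π q.1 q.2 =
          e j * ∏ i' ∈ Finset.Icc 1 i, t j i' * π j i' := by
        have hu : (Finset.Icc 1 U ×ˢ Finset.Icc 1 K).filter
          (fun q : ℕ × ℕ => q.1 < j ∨ (q.1 = j ∧ q.2 ≤ i)) =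
          (Finset.Icc 1 (j - 1) ×ˢ Finset.Icc 1 K) ∪ ({j} ×ˢ Finset.Icc 1 i) := by
          ext ⟨a, b⟩
          simp only [Finset.mem_union, Finset.mem_filter, Finset.mem_product, Finset.mem_Icc,
            Finset.mem_singleton]
          omega
        rw [hu, Finset.prod_union, he, Finset.prod_product {j}, Finset.prod_singleton]
        rw [Finset.disjoint_left]
        rintro ⟨a, b⟩
        simp only [Finset.mem_product, Finset.mem_Icc, Finset.mem_singleton]
        omega
      rw [hT]
      ring
  rw [hF, hF]
  by_cases hz : ∀ p ∈ Finset.Icc 1 U ×ˢ Finset.Icc 1 K, 0 < ρ p.1 p.2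
  · refine aux_core_s15 (Finset.Icc 1 U ×ˢ Finset.Icc 1 K)
      (fun q p : ℕ × ℕ => q.1 < p.1 ∨ (q.1 = p.1 ∧ q.2 ≤ p.2))
      (fun q => t q.1 q.2) (fun q => π q.1 q.2) (fun q => ρ q.1 q.2)
      (fun q hq => htp _ (hS q hq).1 _ (hS q hq).2)
      (fun q hq => hpos _ (hS q hq).1 _ (hS q hq).2) hz ?_
    rw [Finset.sum_product]
    refine Finset.sum_eq_zero fun j hj => ?_
    have hcj := hc j hj
    have : ∑ i ∈ Finset.Icc 1 K, (π j i - ρ j i) / c j = 0 := by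
      rw [← Finset.sum_div, Finset.sum_sub_distrib, hsum j hj, hρ1 j hj]; simp
    rw [← this]
    refine Finset.sum_congr rfl fun i hi => ?_
    have hi' := Finset.mem_Icc.1 hi
    have hk := key j hj i hi'.1 hi'.2
    have hp := hpos j hj i hi
    rw [mul_comm, ← eq_div_iff hcj.ne'] at hk
    simp only
    rw [hk]
    field_simp
  · push Not at hz
    obtain ⟨p, hp, hp0⟩ := hz
    have h0 : ρ p.1 p.2 = 0 := le_antisymm hp0 (hρ0 _ (hS p hp).1 _ (hS p hp).2)
    rw [Finset.prod_eq_zero hp (by rw [h0, mul_zero]), zero_div]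
    have hx : ∀ p ∈ Finset.Icc 1 U ×ˢ Finset.Icc 1 K, 0 ≤ t p.1 p.2 * π p.1 p.2 := fun q hq =>
      (mul_pos (htp _ (hS q hq).1 _ (hS q hq).2) (hpos _ (hS q hq).1 _ (hS q hq).2)).le
    refine div_nonneg (Finset.prod_nonneg hx) (add_nonneg one_pos.le
      (Finset.sum_nonneg fun p _ => Finset.prod_nonneg fun q hq => hx q (Finset.mem_filter.1 hq).1))
end

section
/- Let U ≥ 1, K ≥ 1, and t_{ji} ∈ (0,1] for j = 1,…,U, i = 1,…,K. With F defined on (Δ_K)^U as F(π) = (∏_{j,i} t_{ji}·π_{ji}) / (1 + Σ_{(j,i)} ∏_{(j',i') ≤ (j,i)} t_{j'i'}·π_{j'i'}) (lexicographic order on the pairs), every maximizer π of F over (Δ_K)^U satisfies π_{ji} > 0 for all j and i. Consequently, in the POMDP of Example 6 with U ambiguous sensor states and K actions, every optimal memoryless policy has all U·K entries strictly positive, i.e. it is exactly U·(K−1)-stochastic, matching the upper bound |U|(|A|−1) of the main theorem. -/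
/-- In the multi-sensor chain POMDP of Example 6, every maximizer of
the stationary reward probability `F` over `(Δ_K)^U` has all `U·K` entries strictly
positive; in particular it has exactly `U·K` nonzero entries, i.e. it is exactly
`U·(K−1)`-stochastic, matching the bound `|U|(|A|−1)` of the main theorem. -/
theorem stmt_16
    (U K : ℕ) (hU : 1 ≤ U) (hK : 1 ≤ K)
    (t : ℕ → ℕ → ℝ)
    (ht : ∀ j ∈ Finset.Icc 1 U, ∀ i ∈ Finset.Icc 1 K, t j i ∈ Set.Ioc (0 : ℝ) 1)
    (F : (ℕ → ℕ → ℝ) → ℝ)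
    (hF : ∀ ρ : ℕ → ℕ → ℝ, F ρ =
      (∏ p ∈ Finset.Icc 1 U ×ˢ Finset.Icc 1 K, t p.1 p.2 * ρ p.1 p.2) /
      (1 + ∑ p ∈ Finset.Icc 1 U ×ˢ Finset.Icc 1 K,
        ∏ q ∈ (Finset.Icc 1 U ×ˢ Finset.Icc 1 K).filter
          (fun q : ℕ × ℕ => q.1 < p.1 ∨ (q.1 = p.1 ∧ q.2 ≤ p.2)),
          t q.1 q.2 * ρ q.1 q.2)) :
    ∀ π : ℕ → ℕ → ℝ,
      (∀ j ∈ Finset.Icc 1 U, ∀ i ∈ Finset.Icc 1 K, 0 ≤ π j i) →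
      (∀ j ∈ Finset.Icc 1 U, ∑ i ∈ Finset.Icc 1 K, π j i = 1) →
      (∀ ρ : ℕ → ℕ → ℝ,
        (∀ j ∈ Finset.Icc 1 U, ∀ i ∈ Finset.Icc 1 K, 0 ≤ ρ j i) →
        (∀ j ∈ Finset.Icc 1 U, ∑ i ∈ Finset.Icc 1 K, ρ j i = 1) →
        F ρ ≤ F π) →
      (∀ j ∈ Finset.Icc 1 U, ∀ i ∈ Finset.Icc 1 K, 0 < π j i) ∧
      ((Finset.Icc 1 U ×ˢ Finset.Icc 1 K).filter
        (fun p : ℕ × ℕ => 0 < π p.1 p.2)).card = U * K := by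
  intro π h0 hs hmax
  have hKpos : (0 : ℝ) < (K : ℝ) := by exact_mod_cast hK
  have hpos : ∀ j ∈ Finset.Icc 1 U, ∀ i ∈ Finset.Icc 1 K, 0 < π j i := by
    intro j hj i hi
    rcases lt_or_eq_of_le (h0 j hj i hi) with h | h
    · exact h
    exfalso
    have hzero : F π = 0 := by
      rw [hF, Finset.prod_eq_zero (i := (j, i)) (Finset.mk_mem_product hj hi) (by simp [← h]),
        zero_div]
    have hterm : ∀ p ∈ Finset.Icc 1 U ×ˢ Finset.Icc 1 K,
        0 < t p.1 p.2 * ((fun _ _ => (K : ℝ)⁻¹ : ℕ → ℕ → ℝ) p.1 p.2) := by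
      intro p hp
      rw [Finset.mem_product] at hp
      exact mul_pos (ht p.1 hp.1 p.2 hp.2).1 (inv_pos.mpr hKpos)
    have hle := hmax (fun _ _ => (K : ℝ)⁻¹)
      (fun _ _ _ _ => (inv_pos.mpr hKpos).le)
      (fun _ _ => by simp [hKpos.ne'])
    have hgt : 0 < F (fun _ _ => (K : ℝ)⁻¹) := by
      rw [hF]
      refine div_pos (Finset.prod_pos hterm) ?_
      refine add_pos_of_pos_of_nonneg one_pos (Finset.sum_nonneg fun p _ => ?_)
      exact Finset.prod_nonneg fun q hq => (hterm q (Finset.mem_filter.mp hq).1).le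
    linarith
  refine ⟨hpos, ?_⟩
  rw [Finset.filter_true_of_mem]
  · simp
  · intro p hp
    rw [Finset.mem_product] at hp
    exact hpos p.1 hp.1 p.2 hp.2
end

section
/- Let W be a finite nonempty set and let Ξ := { p ∈ Δ_{W×W} : for every w ∈ W, Σ_{w'} p(w, w') = Σ_{w'} p(w', w) } be the polytope of joint distributions on W×W with equal first and second marginals. Then p is an extreme point of Ξ if and only if there exist a nonempty subset 𝒲 ⊆ W and a permutation σ of 𝒲 that consists of a single cycle on all of 𝒲, such that p(w, w') = 1/|𝒲| if w ∈ 𝒲 and w' = σ(w), and p(w, w') = 0 otherwise. -/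
/-- The uniform distribution on the graph of `σ` over `S`. -/
noncomputable def cyc {W : Type} [DecidableEq W] (S : Finset W) (σ : W → W) : W × W → ℝ :=
  fun e => if e.1 ∈ S ∧ e.2 = σ e.1 then (1 : ℝ) / S.card else 0

/-- The Kirchhoff polytope. -/
def KP (W : Type) [Fintype W] : Set (W × W → ℝ) :=
  {p | p ∈ stdSimplex ℝ (W × W) ∧ ∀ w : W, ∑ w' : W, p (w, w') = ∑ w' : W, p (w', w)}

section
variable {W : Type} [Fintype W] [DecidableEq W]

lemma row_sum {S : Finset W} {σ : W → W} {q : W × W → ℝ}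
    (h0 : ∀ w w', ¬ (w ∈ S ∧ w' = σ w) → q (w, w') = 0) (w : W) :
    ∑ w', q (w, w') = q (w, σ w) := by
  rw [Finset.sum_eq_single (σ w)]
  · intro b _ hb
    exact h0 _ _ (fun h => hb h.2)
  · simp

lemma col_sum {S : Finset W} {σ : W → W} {q : W × W → ℝ} (hb : Set.BijOn σ ↑S ↑S)
    (h0 : ∀ w w', ¬ (w ∈ S ∧ w' = σ w) → q (w, w') = 0) {w : W} (hw : w ∈ S) :
    ∑ w', q (w', σ w) = q (w, σ w) := by
  rw [Finset.sum_eq_single w]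
  · intro b _ hbw
    refine h0 _ _ (fun h => hbw ?_)
    exact hb.injOn (Finset.mem_coe.2 h.1) (Finset.mem_coe.2 hw) h.2.symm
  · simp

lemma cyc_zero (S : Finset W) (σ : W → W) (w w' : W) (h : ¬ (w ∈ S ∧ w' = σ w)) :
    cyc S σ (w, w') = 0 := by
  simp only [cyc]; rw [if_neg h]

lemma cyc_val {S : Finset W} (σ : W → W) {w : W} (h : w ∈ S) :
    cyc S σ (w, σ w) = 1 / S.card := by
  simp [cyc, h]

lemma cyc_mem {S : Finset W} {σ : W → W} (hS : S.Nonempty) (hb : Set.BijOn σ ↑S ↑S) :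
    cyc S σ ∈ KP W := by
  refine ⟨⟨?_, ?_⟩, ?_⟩
  · intro e
    simp only [cyc]
    split_ifs <;> positivity
  · rw [Fintype.sum_prod_type]
    simp_rw [row_sum (cyc_zero S σ)]
    have : ∀ w, cyc S σ (w, σ w) = if w ∈ S then (1 : ℝ) / S.card else 0 := by
      intro w; simp [cyc]
    simp_rw [this]
    have hc : (S.card : ℝ) ≠ 0 := by exact_mod_cast hS.card_pos.ne'
    simp [hc]
  · intro w
    rw [row_sum (cyc_zero S σ)]
    by_cases hw : w ∈ S
    · obtain ⟨v, hv, rfl⟩ := hb.surjOn (Finset.mem_coe.2 hw)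
      rw [col_sum hb (cyc_zero S σ) hv, cyc_val σ hv, cyc_val σ hw]
    · rw [cyc_zero S σ _ _ (fun h => hw h.1), Finset.sum_eq_zero]
      intro v _
      refine cyc_zero S σ _ _ (fun h => hw ?_)
      rw [h.2]
      exact hb.mapsTo h.1

lemma eq_cyc {S : Finset W} {σ : W → W} (hS : S.Nonempty) (hb : Set.BijOn σ ↑S ↑S)
    (ht : ∀ x ∈ S, ∀ y ∈ S, ∃ n : ℕ, σ^[n] x = y) {q : W × W → ℝ} (hq : q ∈ KP W)
    (h0 : ∀ w w', ¬ (w ∈ S ∧ w' = σ w) → q (w, w') = 0) : q = cyc S σ := by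
  obtain ⟨x, hx⟩ := hS
  have step : ∀ w ∈ S, q (σ w, σ (σ w)) = q (w, σ w) := by
    intro w hw
    have := hq.2 (σ w)
    rwa [row_sum h0, col_sum hb h0 hw] at this
  have it : ∀ n : ℕ, σ^[n] x ∈ S ∧ q (σ^[n] x, σ (σ^[n] x)) = q (x, σ x) := by
    intro n
    induction n with
    | zero => exact ⟨hx, rfl⟩
    | succ n ih =>
      rw [Function.iterate_succ_apply']
      exact ⟨hb.mapsTo ih.1, (step _ ih.1).trans ih.2⟩
  have const : ∀ y ∈ S, q (y, σ y) = q (x, σ x) := by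
    intro y hy
    obtain ⟨n, rfl⟩ := ht x hx y hy
    exact (it n).2
  have tot := hq.1.2
  rw [Fintype.sum_prod_type] at tot
  simp_rw [row_sum h0] at tot
  rw [← Finset.sum_subset (Finset.subset_univ S) (fun w _ hw => h0 _ _ (fun h => hw h.1)),
    Finset.sum_congr rfl const, Finset.sum_const, nsmul_eq_mul] at tot
  have hc : (S.card : ℝ) ≠ 0 := by
    intro h; rw [h] at tot; simp at tot
  ext ⟨w, w'⟩
  by_cases h : w ∈ S ∧ w' = σ w
  · obtain ⟨hw, rfl⟩ := h
    rw [cyc_val σ hw, const w hw]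
    field_simp
    linarith
  · rw [h0 _ _ h, cyc_zero S σ _ _ h]

lemma cyc_extreme {S : Finset W} {σ : W → W} (hS : S.Nonempty) (hb : Set.BijOn σ ↑S ↑S)
    (ht : ∀ x ∈ S, ∀ y ∈ S, ∃ n : ℕ, σ^[n] x = y) :
    cyc S σ ∈ (KP W).extremePoints ℝ := by
  refine ⟨cyc_mem hS hb, ?_⟩
  rintro x hx y hy ⟨a, b, ha, hb', hab, h⟩
  refine eq_cyc hS hb ht hx ?_
  intro w w' hn
  have h1 := congrFun h (w, w')
  rw [cyc_zero S σ _ _ hn] at h1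
  simp only [Pi.add_apply, Pi.smul_apply, smul_eq_mul] at h1
  have hx0 := hx.1.1 (w, w')
  have hy0 := hy.1.1 (w, w')
  have : a * x (w, w') = 0 := by nlinarith [mul_nonneg ha.le hx0, mul_nonneg hb'.le hy0]
  exact (mul_eq_zero.1 this).resolve_left ha.ne'

lemma exists_cycle {p : W × W → ℝ} (hp : p ∈ KP W) :
    ∃ (S : Finset W) (σ : W → W), S.Nonempty ∧ Set.BijOn σ ↑S ↑S ∧
      (∀ x ∈ S, ∀ y ∈ S, ∃ n : ℕ, σ^[n] x = y) ∧ ∀ w ∈ S, 0 < p (w, σ w) := by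
  have hnn := hp.1.1
  have next : ∀ w, (∃ v, 0 < p (w, v)) → ∃ v, 0 < p (w, v) ∧ ∃ u, 0 < p (v, u) := by
    rintro w ⟨v, hv⟩
    refine ⟨v, hv, ?_⟩
    by_contra! hcon
    have h1 : ∑ u, p (v, u) ≤ 0 := Finset.sum_nonpos (fun u _ => hcon u)
    rw [hp.2 v] at h1
    have h2 : p (w, v) ≤ ∑ u, p (u, v) :=
      Finset.single_le_sum (f := fun u => p (u, v)) (fun u _ => hnn (u, v)) (Finset.mem_univ w)
    linarith
  have next' : ∀ w, ∃ v, (∃ v, 0 < p (w, v)) → (0 < p (w, v) ∧ ∃ u, 0 < p (v, u)) := by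
    intro w
    by_cases h : ∃ v, 0 < p (w, v)
    · obtain ⟨v, hv⟩ := next w h
      exact ⟨v, fun _ => hv⟩
    · exact ⟨w, fun h' => absurd h' h⟩
  choose σ hσ using next'
  have h0 : ∃ w v, 0 < p (w, v) := by
    by_contra! hcon
    have h1 : ∑ e, p e ≤ 0 := Finset.sum_nonpos (fun e _ => hcon e.1 e.2)
    rw [hp.1.2] at h1
    linarith
  obtain ⟨w0, hw0⟩ := h0
  have pos : ∀ n : ℕ, ∃ v, 0 < p (σ^[n] w0, v) := by
    intro n
    induction n with
    | zero => exact hw0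
    | succ n ih =>
      rw [Function.iterate_succ_apply']
      exact (hσ _ ih).2
  have per : ∃ m k : ℕ, 0 < k ∧ σ^[k] (σ^[m] w0) = σ^[m] w0 := by
    obtain ⟨m, n, hne, heq⟩ := Finite.exists_ne_map_eq_of_infinite (fun n : ℕ => σ^[n] w0)
    rcases lt_or_gt_of_ne hne with h | h
    · refine ⟨m, n - m, by omega, ?_⟩
      rw [← Function.iterate_add_apply, Nat.sub_add_cancel h.le, heq]
    · refine ⟨n, m - n, by omega, ?_⟩
      rw [← Function.iterate_add_apply, Nat.sub_add_cancel h.le, heq]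
  obtain ⟨m, k, hk, hper⟩ := per
  have posx : ∀ n : ℕ, ∃ v, 0 < p (σ^[n] (σ^[m] w0), v) := by
    intro n
    rw [← Function.iterate_add_apply]
    exact pos _
  generalize σ^[m] w0 = x at hper posx
  classical
  have hS : ∀ y, y ∈ (Finset.univ.filter fun y => ∃ n : ℕ, σ^[n] x = y) ↔
    ∃ n : ℕ, σ^[n] x = y := by simp
  generalize (Finset.univ.filter fun y => ∃ n : ℕ, σ^[n] x = y) = S at hS
  have hmaps : Set.MapsTo σ (S : Set W) S := by
    intro y hy
    obtain ⟨n, rfl⟩ := (hS y).1 hy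
    exact (hS _).2 ⟨n + 1, Function.iterate_succ_apply' ..⟩
  have hsurj : Set.SurjOn σ (S : Set W) S := by
    intro y hy
    obtain ⟨n, rfl⟩ := (hS y).1 hy
    refine ⟨σ^[n + (k - 1)] x, (hS _).2 ⟨_, rfl⟩, ?_⟩
    rw [← Function.iterate_succ_apply' σ, show (n + (k - 1)).succ = n + k by omega,
      Function.iterate_add_apply, hper]
  refine ⟨S, σ, ⟨x, (hS x).2 ⟨0, rfl⟩⟩, ⟨hmaps, ?_, hsurj⟩, ?_, ?_⟩
  · exact Finset.injOn_of_surjOn_of_card_le σ hmaps hsurj le_rfl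
  · intro y hy z hz
    obtain ⟨a, rfl⟩ := (hS y).1 hy
    obtain ⟨b, rfl⟩ := (hS z).1 hz
    refine ⟨b + (k * a - a), ?_⟩
    have : a ≤ k * a := Nat.le_mul_of_pos_left a hk
    rw [← Function.iterate_add_apply, show b + (k * a - a) + a = b + k * a by omega,
      Function.iterate_add_apply, Function.iterate_mul, Function.iterate_fixed hper]
  · intro w hw
    obtain ⟨n, rfl⟩ := (hS w).1 hw
    exact (hσ _ (posx n)).1

lemma extreme_eq {p : W × W → ℝ} (hp : p ∈ (KP W).extremePoints ℝ) {S : Finset W} {σ : W → W}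
    (hS : S.Nonempty) (hb : Set.BijOn σ ↑S ↑S) (hpos : ∀ w ∈ S, 0 < p (w, σ w)) :
    p = cyc S σ := by
  have hc := cyc_mem hS hb
  obtain ⟨w1, hw1, hmin⟩ := S.exists_min_image (fun w => p (w, σ w)) hS
  obtain ⟨t, ht0, ht1, htp⟩ : ∃ t : ℝ, 0 < t ∧ t < 1 ∧ t ≤ p (w1, σ w1) :=
    ⟨min (p (w1, σ w1)) (1 / 2), lt_min (hpos _ hw1) (by norm_num),
      (min_le_right _ _).trans_lt (by norm_num), min_le_left _ _⟩
  have hle : ∀ e, t * cyc S σ e ≤ p e := by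
    rintro ⟨w, w'⟩
    by_cases h : w ∈ S ∧ w' = σ w
    · obtain ⟨hw, rfl⟩ := h
      have h1 : cyc S σ (w, σ w) ≤ 1 := by
        rw [cyc_val σ hw]
        have : (1 : ℝ) ≤ S.card := by exact_mod_cast hS.card_pos
        exact (div_le_one (by linarith)).2 this
      have := hmin w hw
      nlinarith
    · rw [cyc_zero S σ _ _ h, mul_zero]
      exact hp.1.1.1 _
  have h1t : 0 < 1 - t := by linarith
  let q : W × W → ℝ := fun e => (1 - t)⁻¹ * (p e - t * cyc S σ e)
  have hq : q ∈ KP W := by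
    refine ⟨⟨fun e => ?_, ?_⟩, fun w => ?_⟩
    · exact mul_nonneg (inv_nonneg.2 h1t.le) (sub_nonneg.2 (hle e))
    · simp only [q]
      rw [← Finset.mul_sum, Finset.sum_sub_distrib, ← Finset.mul_sum, hp.1.1.2, hc.1.2, mul_one,
        inv_mul_cancel₀ h1t.ne']
    · simp only [q]
      simp only [← Finset.mul_sum, Finset.sum_sub_distrib, hp.1.2 w, hc.2 w]
  refine (hp.2 hc hq ⟨t, 1 - t, ht0, h1t, by ring, ?_⟩).symm
  ext e
  simp only [q, Pi.add_apply, Pi.smul_apply, smul_eq_mul]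
  rw [mul_inv_cancel_left₀ h1t.ne']
  ring

end


/-- The extreme points of the Kirchhoff polytope `Ξ` (joint
distributions on `W×W` with equal marginals) are exactly the uniform distributions on
the graphs of single cycles `σ` on nonempty subsets `𝒲 ⊆ W`. -/
theorem stmt_17
    {W : Type} [Fintype W] [Nonempty W] [DecidableEq W]
    (Ξ : Set (W × W → ℝ))
    (hΞ : Ξ = {p | p ∈ stdSimplex ℝ (W × W) ∧
      ∀ w : W, ∑ w' : W, p (w, w') = ∑ w' : W, p (w', w)})
    (p : W × W → ℝ) :
    p ∈ Ξ.extremePoints ℝ ↔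
      ∃ (𝒲 : Finset W) (σ : W → W), 𝒲.Nonempty ∧
        Set.BijOn σ ↑𝒲 ↑𝒲 ∧
        (∀ x ∈ 𝒲, ∀ y ∈ 𝒲, ∃ n : ℕ, σ^[n] x = y) ∧
        ∀ w w' : W, p (w, w') =
          if w ∈ 𝒲 ∧ w' = σ w then (1 : ℝ) / 𝒲.card else 0 := by
  have hK : Ξ = KP W := hΞ
  rw [hK]
  constructor
  · intro hp
    obtain ⟨S, σ, hS, hb, ht, hpos⟩ := exists_cycle hp.1
    refine ⟨S, σ, hS, hb, ht, fun w w' => ?_⟩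
    rw [extreme_eq hp hS hb hpos]
    rfl
  · rintro ⟨S, σ, hS, hb, ht, h⟩
    have : p = cyc S σ := by
      ext ⟨w, w'⟩
      exact h w w'
    rw [this]
    exact cyc_extreme hS hb ht
end

section
/- Let W be a finite nonempty set with |W| ≥ 1 and let Ξ := { p ∈ Δ_{W×W} : for every w ∈ W, Σ_{w'} p(w, w') = Σ_{w'} p(w', w) }. Then the dimension of the affine hull of Ξ, as a subset of ℝ^{W×W}, equals |W|·(|W|−1). -/
/-- The Kirchhoff polytope `Ξ ⊆ ℝ^{W×W}` of joint distributions with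
equal first and second marginals has affine dimension `|W|·(|W|−1)`. -/
theorem stmt_18
    {W : Type} [Fintype W] [Nonempty W]
    (Ξ : Set (W × W → ℝ))
    (hΞ : Ξ = {p | p ∈ stdSimplex ℝ (W × W) ∧
      ∀ w : W, ∑ w' : W, p (w, w') = ∑ w' : W, p (w', w)}) :
    Module.finrank ℝ (affineSpan ℝ Ξ).direction
      = Fintype.card W * (Fintype.card W - 1) := by
  classical
  obtain ⟨w0⟩ := ‹Nonempty W›
  let T : (W × W → ℝ) →ₗ[ℝ] (W → ℝ) :=
    { toFun := fun p w => if w = w0 then ∑ x, p x else ∑ w', p (w, w') - ∑ w', p (w', w)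
      map_add' := by
        intro p q
        ext w
        by_cases h : w = w0
        · simp [h, Finset.sum_add_distrib]
        · simp [h, Finset.sum_add_distrib]; ring
      map_smul' := by
        intro c p
        ext w
        by_cases h : w = w0
        · simp [h, Finset.mul_sum]
        · simp [h, ← Finset.mul_sum]; ring }
  have hT : ∀ p w, T p w = if w = w0 then ∑ x, p x else ∑ w', p (w, w') - ∑ w', p (w', w) :=
    fun _ _ => rfl
  have hker : ∀ p, p ∈ LinearMap.ker T ↔
      (∑ x, p x = 0 ∧ ∀ w, ∑ w', p (w, w') = ∑ w', p (w', w)) := by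
    intro p
    rw [LinearMap.mem_ker]
    constructor
    · intro h
      have h1 : ∀ w, w ≠ w0 → ∑ w', p (w, w') - ∑ w', p (w', w) = 0 := by
        intro w hw
        have := congrFun h w
        rw [hT, if_neg hw] at this
        exact this
      refine ⟨?_, ?_⟩
      · have := congrFun h w0
        rw [hT, if_pos rfl] at this
        exact this
      · intro w
        by_cases hw : w = w0
        · subst hw
          have h2 : ∑ w, (∑ w', p (w, w') - ∑ w', p (w', w)) = 0 := by
            rw [Finset.sum_sub_distrib, Finset.sum_comm, sub_self]
          rw [Finset.sum_eq_single w (fun b _ hb => h1 b hb) (by simp)] at h2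
          linarith
        · linarith [h1 w hw]
    · rintro ⟨h1, h2⟩
      ext w
      rw [hT, h1, h2 w]
      simp
  have hsurj : Function.Surjective T := by
    intro g
    refine ⟨fun x => if x.2 = w0 then (g x.1 + if x.1 = w0 then g w0 - ∑ a, g a else 0) else 0, ?_⟩
    ext w
    rw [hT]
    by_cases h : w = w0
    · subst h
      simp [Fintype.sum_prod_type, Finset.sum_add_distrib]
    · simp [h]
  have hdir : (affineSpan ℝ Ξ).direction = LinearMap.ker T := by
    rw [direction_affineSpan]
    apply le_antisymm
    · rw [vectorSpan_def, Submodule.span_le]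
      rintro _ ⟨p, hp, q, hq, rfl⟩
      rw [hΞ] at hp hq
      obtain ⟨⟨_, hp1⟩, hp2⟩ := hp
      obtain ⟨⟨_, hq1⟩, hq2⟩ := hq
      rw [SetLike.mem_coe, hker]
      simp [Finset.sum_sub_distrib, hp1, hq1, hp2, hq2]
    · intro v hv
      obtain ⟨hv1, hv2⟩ := (hker v).1 hv
      have hn : (0 : ℝ) < ((Fintype.card (W × W) : ℕ) : ℝ) := by
        have : Nonempty (W × W) := ⟨(w0, w0)⟩
        exact_mod_cast Fintype.card_pos
      set N : ℝ := ((Fintype.card (W × W) : ℕ) : ℝ) with hN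
      have hS : 0 < 1 + ∑ x, |v x| := by
        have := Finset.sum_nonneg (s := Finset.univ) (fun x _ => abs_nonneg (v x))
        linarith
      set S : ℝ := 1 + ∑ x, |v x| with hSd
      have key : ∀ c : ℝ, 0 ≤ c → c ≤ 1 → (fun x => N⁻¹ + c * (N⁻¹ * (S⁻¹ * v x))) ∈ Ξ := by
        intro c hc hc1
        rw [hΞ]
        refine ⟨⟨?_, ?_⟩, ?_⟩
        · intro x
          have hx : |v x| ≤ S := by
            have := Finset.single_le_sum (f := fun x => |v x|) (fun x _ => abs_nonneg (v x))
              (Finset.mem_univ x)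
            linarith
          have h3 : -1 ≤ S⁻¹ * v x := by
            have h4 := neg_abs_le (v x)
            rw [inv_mul_eq_div, le_div_iff₀ hS]
            linarith
          have h5 : 0 ≤ 1 + c * (S⁻¹ * v x) := by nlinarith
          have h6 := mul_nonneg (inv_pos.2 hn).le h5
          show 0 ≤ N⁻¹ + c * (N⁻¹ * (S⁻¹ * v x))
          linarith
        · simp only [Finset.sum_add_distrib, ← Finset.mul_sum, hv1, Finset.sum_const,
            Finset.card_univ, nsmul_eq_mul]
          rw [← hN, mul_inv_cancel₀ hn.ne']
          ring
        · intro w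
          simp only [Finset.sum_add_distrib, ← Finset.mul_sum, hv2 w]
      have h := vsub_mem_vectorSpan ℝ (key 1 (by norm_num) le_rfl) (key 0 le_rfl (by norm_num))
      have h7 := Submodule.smul_mem _ (N * S) h
      convert h7 using 1
      ext x
      simp
      field_simp
  rw [hdir]
  have h := T.finrank_range_add_finrank_ker
  rw [LinearMap.range_eq_top.2 hsurj, finrank_top] at h
  simp only [Module.finrank_fintype_fun_eq_card, Fintype.card_prod] at h
  rw [Nat.mul_sub, mul_one]
  omega
end
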